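/- arXiv:1912.02440 — 2 statements merged into one kernel-verified Lean document; each statement's English description precedes it below -/
import Mathlib

section
/- For every n ≥ 1, the ℂ(q)-algebra U_q^{⊗n} (the n-fold tensor product of U_q(sl(2)) over ℂ(q)) has no nontrivial zero divisors. -/
noncomputable section

open scoped TensorProduct

abbrev Kq : Type := RatFunc ℂ

/-- The indeterminate `q`. -/
noncomputable def qv : Kq := RatFunc.X

/-- Generators `E`, `F`, `K`, `K⁻¹` of the quantum group `U_q(sl(2))`. -/
inductive UGen : Type
  | E | F | K | Kinv

/-- The defining relations of `U_q(sl(2))`. -/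
inductive URel : FreeAlgebra Kq UGen → FreeAlgebra Kq UGen → Prop
  | KKinv : URel (FreeAlgebra.ι Kq UGen.K * FreeAlgebra.ι Kq UGen.Kinv) 1
  | KinvK : URel (FreeAlgebra.ι Kq UGen.Kinv * FreeAlgebra.ι Kq UGen.K) 1
  | KE : URel (FreeAlgebra.ι Kq UGen.K * FreeAlgebra.ι Kq UGen.E * FreeAlgebra.ι Kq UGen.Kinv)
      ((qv ^ 2) • FreeAlgebra.ι Kq UGen.E)
  | KF : URel (FreeAlgebra.ι Kq UGen.K * FreeAlgebra.ι Kq UGen.F * FreeAlgebra.ι Kq UGen.Kinv)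
      ((qv⁻¹ ^ 2) • FreeAlgebra.ι Kq UGen.F)
  | EF : URel (FreeAlgebra.ι Kq UGen.E * FreeAlgebra.ι Kq UGen.F
        - FreeAlgebra.ι Kq UGen.F * FreeAlgebra.ι Kq UGen.E)
      (((qv - qv⁻¹)⁻¹) • (FreeAlgebra.ι Kq UGen.K - FreeAlgebra.ι Kq UGen.Kinv))

/-- The quantum group `U_q = U_q(sl(2))`, presented by generators and relations. -/
abbrev Uq : Type := RingQuot URel

noncomputable def Eel : Uq := RingQuot.mkAlgHom Kq URel (FreeAlgebra.ι Kq UGen.E)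
noncomputable def Fel : Uq := RingQuot.mkAlgHom Kq URel (FreeAlgebra.ι Kq UGen.F)
noncomputable def Kel : Uq := RingQuot.mkAlgHom Kq URel (FreeAlgebra.ι Kq UGen.K)
noncomputable def Kinvel : Uq := RingQuot.mkAlgHom Kq URel (FreeAlgebra.ι Kq UGen.Kinv)

/-- Bundled `ℂ(q)`-algebras, used to form iterated tensor powers of `U_q`. -/
structure AlgBundle : Type 1 where
  carrier : Type
  [ringInst : Ring carrier]
  [algInst : Algebra Kq carrier]

attribute [instance] AlgBundle.ringInst AlgBundle.algInst

/-- `TpowB n` bundles the `(n+1)`-fold tensor power `U_q ⊗ ⋯ ⊗ U_q`. -/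
noncomputable def TpowB : ℕ → AlgBundle
  | 0 => { carrier := Uq }
  | n + 1 => { carrier := (TpowB n).carrier ⊗[Kq] Uq }

/-- The `(n+1)`-fold tensor power `U_q^{⊗(n+1)}`. -/
abbrev Tpow (n : ℕ) : Type := (TpowB n).carrier

open Module

/-- If the `k`-algebra `B` has a basis indexed by a type with unique sums, in which the product of
two basis vectors is a nonzero multiple of the basis vector indexed by the sum, then `A ⊗ B` is a
domain for every `k`-algebra `A` without zero divisors. -/
theorem noZeroDivisors_tensorProduct_of_twisted_basis {k A B G : Type*} [Field k] [Ring A]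
    [Algebra k A] [NoZeroDivisors A] [Semiring B] [Algebra k B] [Add G] [UniqueSums G]
    (b : Basis G k B) (c : G → G → k) (hc : ∀ g h, c g h ≠ 0)
    (hb : ∀ g h, b g * b h = c g h • b (g + h)) : NoZeroDivisors (A ⊗[k] B) where
  eq_zero_or_eq_zero_of_mul_eq_zero {x y} hxy := by
    classical
    set β := Algebra.TensorProduct.basis A b
    by_contra! hne
    obtain ⟨hx, hy⟩ := hne
    have hx' : (β.repr x).support.Nonempty := by simpa [Finsupp.support_nonempty_iff] using hx
    have hy' : (β.repr y).support.Nonempty := by simpa [Finsupp.support_nonempty_iff] using hy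
    obtain ⟨g₀, hg₀, h₀, hh₀, hu⟩ := UniqueSums.uniqueAdd_of_nonempty hx' hy'
    have expand (z : A ⊗[k] B) : z = ∑ g ∈ (β.repr z).support, β.repr z g ⊗ₜ[k] b g := by
      conv_lhs => rw [← β.linearCombination_repr z, Finsupp.linearCombination_apply, Finsupp.sum]
      exact Finset.sum_congr rfl fun g _ => Algebra.TensorProduct.basis_repr_symm_apply' b _ g
    have hcoef : β.repr (x * y) (g₀ + h₀) = c g₀ h₀ • (β.repr x g₀ * β.repr y h₀) := by
      conv_lhs => rw [expand x, expand y, Finset.sum_mul_sum]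
      simp only [Algebra.TensorProduct.tmul_mul_tmul, hb, TensorProduct.tmul_smul,
        TensorProduct.smul_tmul', map_sum, Finsupp.finsetSum_apply]
      rw [Finset.sum_eq_single_of_mem g₀ hg₀, Finset.sum_eq_single_of_mem h₀ hh₀]
      · simp [β]
      · intro h hh hne
        have : g₀ + h ≠ g₀ + h₀ := fun e => hne (hu hg₀ hh e).2
        simp [β, this]
      · intro g hg hne
        refine Finset.sum_eq_zero fun h hh => ?_
        have : g + h ≠ g₀ + h₀ := fun e => hne (hu hg hh e).1
        simp [β, this]
    rw [hxy, map_zero, Finsupp.zero_apply] at hcoef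
    rcases smul_eq_zero.1 hcoef.symm with h | h
    · exact hc _ _ h
    · rcases mul_eq_zero.1 h with h | h
      · exact Finsupp.mem_support_iff.1 hg₀ h
      · exact Finsupp.mem_support_iff.1 hh₀ h

/-- Exponents `(m, j, l)` of the monomials `F ^ m * K ^ j * C ^ l`. -/
abbrev TorusExp : Type := ℤ × ℤ × ℕ

section QTorus

variable {k : Type*} [Field k] (q : kˣ)

/-- The bicharacter that twists the product of monomials. -/
def torusTwist (g h : TorusExp) : k := (q ^ (-2 * g.2.1 * h.1) : kˣ)

theorem torusTwist_ne_zero (g h : TorusExp) : torusTwist q g h ≠ 0 := Units.ne_zero _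

/-- Left multiplication by a monomial on the space spanned by all monomials. -/
def torusOp (g : TorusExp) : Module.End k (TorusExp →₀ k) :=
  Finsupp.linearCombination k fun h => Finsupp.single (g + h) (torusTwist q g h)

theorem torusOp_single (g h : TorusExp) (a : k) :
    torusOp q g (Finsupp.single h a) = Finsupp.single (g + h) (a * torusTwist q g h) := by
  simp [torusOp]

theorem torusOp_mul (g h : TorusExp) :
    torusOp q g * torusOp q h = torusTwist q g h • torusOp q (g + h) := by
  refine Finsupp.lhom_ext fun i a => ?_
  simp only [Module.End.mul_apply, LinearMap.smul_apply, torusOp_single, add_assoc,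
    Finsupp.smul_single, smul_eq_mul]
  congr 1
  have : torusTwist q h i * torusTwist q g (h + i) =
      torusTwist q g h * torusTwist q (g + h) i := by
    simp only [torusTwist, ← Units.val_mul, ← zpow_add, Prod.fst_add, Prod.snd_add]
    congr 2
    ring
  linear_combination a * this

theorem torusOp_zero : torusOp q 0 = 1 := by
  refine Finsupp.lhom_ext fun i a => ?_
  simp [torusOp_single, torusTwist]

theorem linearIndependent_torusOp : LinearIndependent k (torusOp q) := by
  refine LinearIndependent.of_comp (LinearMap.applyₗ (Finsupp.single 0 1)) ?_
  convert (Finsupp.basisSingleOne (R := k) (ι := TorusExp)).linearIndependent using 1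
  ext1 g
  simp [torusOp_single, torusTwist]

/-- The algebra spanned by the operators `torusOp q g`. -/
def torusSubalgebra : Subalgebra k (Module.End k (TorusExp →₀ k)) :=
  (Submodule.span k (Set.range (torusOp q))).toSubalgebra
    (Submodule.subset_span ⟨0, torusOp_zero q⟩) fun x y hx hy => by
      have h := Submodule.mul_mem_mul hx hy
      rw [Submodule.span_mul_span] at h
      refine Submodule.span_le.2 ?_ h
      rintro _ ⟨_, ⟨g, rfl⟩, _, ⟨h, rfl⟩, rfl⟩
      simp only [torusOp_mul]
      exact Submodule.smul_mem _ _ (Submodule.subset_span ⟨_, rfl⟩)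

/-- The tensor product of a polynomial ring `k[C]` and the quantum torus generated by `F`, `K`
subject to `K F = q⁻² F K`. -/
def QTorus : Type _ := torusSubalgebra q

instance : Semiring (QTorus q) := inferInstanceAs (Semiring (torusSubalgebra q))

instance : Algebra k (QTorus q) := inferInstanceAs (Algebra k (torusSubalgebra q))

instance : Ring (QTorus q) := Algebra.semiringToRing k

/-- The inclusion of `QTorus q` into the algebra of operators. -/
def QTorus.val : QTorus q →ₐ[k] Module.End k (TorusExp →₀ k) := (torusSubalgebra q).val

theorem QTorus.val_injective : Function.Injective (QTorus.val q) := Subtype.val_injective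

/-- The basis of monomials `F ^ m * K ^ j * C ^ l`. -/
def torusBasis : Basis TorusExp k (QTorus q) :=
  (Basis.span (linearIndependent_torusOp q)).map
    (Subalgebra.toSubmoduleEquiv (torusSubalgebra q) :
      (Subalgebra.toSubmodule (torusSubalgebra q)) ≃ₗ[k] QTorus q)

theorem val_torusBasis (g : TorusExp) : QTorus.val q (torusBasis q g) = torusOp q g :=
  congrArg Subtype.val (Basis.span_apply (linearIndependent_torusOp q) g)

theorem torusBasis_mul (g h : TorusExp) :
    torusBasis q g * torusBasis q h = torusTwist q g h • torusBasis q (g + h) :=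
  QTorus.val_injective q <| by simp [val_torusBasis, torusOp_mul]

theorem torusBasis_zero : torusBasis q 0 = 1 :=
  QTorus.val_injective q <| by simp [val_torusBasis, torusOp_zero]

instance noZeroDivisors_tensorProduct_qTorus (A : Type*) [Ring A] [Algebra k A]
    [NoZeroDivisors A] : NoZeroDivisors (A ⊗[k] QTorus q) :=
  noZeroDivisors_tensorProduct_of_twisted_basis (torusBasis q) (torusTwist q)
    (torusTwist_ne_zero q) (torusBasis_mul q)

instance noZeroDivisors_qTorus : NoZeroDivisors (QTorus q) :=
  (Algebra.TensorProduct.lid k (QTorus q)).symm.toMulEquiv.injective.noZeroDivisors _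
    (map_zero _) (map_mul _)

/-- The span of the monomials of degree `m` in `F`. -/
def torusWeight (m : ℤ) : Submodule k (QTorus q) :=
  Submodule.span k (torusBasis q '' {g | g.1 = m})

theorem torusBasis_mem_torusWeight (g : TorusExp) : torusBasis q g ∈ torusWeight q g.1 :=
  Submodule.subset_span ⟨g, rfl, rfl⟩

theorem one_mem_torusWeight : (1 : QTorus q) ∈ torusWeight q 0 :=
  torusBasis_zero q ▸ torusBasis_mem_torusWeight q 0

theorem mul_mem_torusWeight {m n : ℤ} {x y : QTorus q} (hx : x ∈ torusWeight q m)
    (hy : y ∈ torusWeight q n) : x * y ∈ torusWeight q (m + n) := by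
  induction hx using Submodule.span_induction with
  | mem x hx =>
    obtain ⟨g, rfl, rfl⟩ := hx
    induction hy using Submodule.span_induction with
    | mem y hy =>
      obtain ⟨h, rfl, rfl⟩ := hy
      rw [torusBasis_mul]
      exact Submodule.smul_mem _ _ (torusBasis_mem_torusWeight q (g + h))
    | zero => rw [mul_zero]; exact zero_mem _
    | add y z _ _ hy hz => rw [mul_add]; exact add_mem hy hz
    | smul a y _ hy => rw [mul_smul_comm]; exact Submodule.smul_mem _ _ hy
  | zero => rw [zero_mul]; exact zero_mem _
  | add x z _ _ hx hz => rw [add_mul]; exact add_mem hx hz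
  | smul a x _ hx => rw [smul_mul_assoc]; exact Submodule.smul_mem _ _ hx

theorem pow_mem_torusWeight {m : ℤ} {x : QTorus q} (hx : x ∈ torusWeight q m) (n : ℕ) :
    x ^ n ∈ torusWeight q (n * m) := by
  induction n with
  | zero => simpa using one_mem_torusWeight q
  | succ n ih =>
    have := mul_mem_torusWeight q ih hx
    rw [pow_succ]
    convert this using 1
    push_cast
    ring_nf

/-- The projection onto `torusWeight q m`. -/
def torusProj (m : ℤ) : QTorus q →ₗ[k] QTorus q :=
  (torusBasis q).constr k fun g => if g.1 = m then torusBasis q g else 0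

theorem torusProj_of_mem {m n : ℤ} {x : QTorus q} (hx : x ∈ torusWeight q n) :
    torusProj q m x = if n = m then x else 0 := by
  induction hx using Submodule.span_induction with
  | mem x hx =>
    obtain ⟨g, rfl, rfl⟩ := hx
    simp [torusProj, Basis.constr_basis]
  | zero => simp
  | add x y _ _ hx hy => rw [map_add, hx, hy]; split_ifs <;> simp
  | smul a x _ hx => rw [map_smul, hx]; split_ifs <;> simp

/-- If each `X m` is a nonzero element of weight `m`, the products of the `X m` with the monomials
in `K` and `C` are linearly independent. -/
theorem linearIndependent_weight_mul {X : ℤ → QTorus q} (hX : ∀ m, X m ∈ torusWeight q m)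
    (hX0 : ∀ m, X m ≠ 0) :
    LinearIndependent k fun g : TorusExp => X g.1 * torusBasis q (0, g.2) := by
  classical
  rw [linearIndependent_iff']
  intro s f hf g hg
  have hproj (i : TorusExp) : torusProj q g.1 (X i.1 * torusBasis q (0, i.2)) =
      if i.1 = g.1 then X i.1 * torusBasis q (0, i.2) else 0 := by
    refine torusProj_of_mem q ?_
    simpa using mul_mem_torusWeight q (hX i.1) (torusBasis_mem_torusWeight q (0, i.2))
  have h1 := congrArg (torusProj q g.1) hf
  simp only [map_sum, map_smul, hproj, map_zero] at h1
  have h2 : X g.1 * ∑ i ∈ s with i.1 = g.1, f i • torusBasis q (0, i.2) = 0 := by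
    rw [← h1, Finset.mul_sum, Finset.sum_filter]
    refine Finset.sum_congr rfl fun i _ => ?_
    split_ifs with hi
    · rw [hi, mul_smul_comm]
    · simp
  have h3 := (mul_eq_zero.1 h2).resolve_left (hX0 _)
  have h4 := congrArg (fun z => (torusBasis q).repr z (0, g.2)) h3
  simp only [map_sum, map_smul, Basis.repr_self, Finsupp.finsetSum_apply, map_zero,
    Finsupp.zero_apply] at h4
  rw [Finset.sum_eq_single g] at h4
  · simpa using h4
  · intro i hi hne
    have : i.2 ≠ g.2 := fun e => hne (Prod.ext (Finset.mem_filter.1 hi).2 e)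
    simp [this]
  · intro h
    simp [hg] at h

/-- The scalar `(q - q⁻¹)⁻²` occurring in the Casimir element. -/
def casimirScalar : k := (((q : k) - (q : k)⁻¹) ^ 2)⁻¹

/-- The image of `E` in the quantum torus. -/
def torusE : QTorus q :=
  torusBasis q (-1, 0, 1) - casimirScalar q •
    ((q : k) • torusBasis q (-1, 1, 0) + (q : k)⁻¹ • torusBasis q (-1, -1, 0))

theorem torusE_mem_torusWeight : torusE q ∈ torusWeight q (-1) := by
  have h (j : ℤ) (l : ℕ) : torusBasis q (-1, j, l) ∈ torusWeight q (-1) :=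
    torusBasis_mem_torusWeight q (-1, j, l)
  exact sub_mem (h _ _) (Submodule.smul_mem _ _ (add_mem (Submodule.smul_mem _ _ (h _ _))
    (Submodule.smul_mem _ _ (h _ _))))

theorem torusE_ne_zero : torusE q ≠ 0 := by
  intro h
  have := congrArg (fun z => (torusBasis q).repr z (-1, 0, 1)) h
  simp [torusE] at this

theorem torusF_mul_torusE : torusBasis q (1, 0, 0) * torusE q = torusBasis q (0, 0, 1) -
    casimirScalar q • ((q : k) • torusBasis q (0, 1, 0) + (q : k)⁻¹ • torusBasis q (0, -1, 0)) := by
  simp [torusE, mul_sub, mul_add, torusBasis_mul, torusTwist]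

theorem torusE_mul_torusF : torusE q * torusBasis q (1, 0, 0) = torusBasis q (0, 0, 1) -
    casimirScalar q • ((q : k)⁻¹ • torusBasis q (0, 1, 0) + (q : k) • torusBasis q (0, -1, 0)) := by
  have h1 : (q : k) * (q ^ 2 : k)⁻¹ = (q : k)⁻¹ := by field_simp [q.ne_zero]
  have h2 : (q : k)⁻¹ * (q ^ 2 : k) = (q : k) := by field_simp [q.ne_zero]
  simp [torusE, sub_mul, add_mul, torusBasis_mul, torusTwist, smul_smul, mul_assoc, h1, h2]

end QTorus

theorem qv_ne_zero : qv ≠ 0 := RatFunc.X_ne_zero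

theorem qv_sub_inv_ne_zero : qv - qv⁻¹ ≠ 0 := by
  intro h
  have h2 : qv ^ 2 = 1 := by
    have := congrArg (· * qv) h
    simp only [sub_mul, inv_mul_cancel₀ qv_ne_zero, zero_mul] at this
    linear_combination this
  have h3 : (Polynomial.X ^ 2 : Polynomial ℂ) = 1 := by
    apply RatFunc.algebraMap_injective ℂ
    simpa [qv, RatFunc.algebraMap_X] using h2
  simpa using congrArg Polynomial.natDegree h3

/-- The indeterminate as a unit. -/
def qUnit : Kqˣ := Units.mk0 qv qv_ne_zero

theorem coe_qUnit : (qUnit : Kq) = qv := rfl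

section Relations

theorem Kel_mul_Kinvel : Kel * Kinvel = 1 := by
  simpa [Kel, Kinvel] using RingQuot.mkAlgHom_rel Kq URel.KKinv

theorem Kinvel_mul_Kel : Kinvel * Kel = 1 := by
  simpa [Kel, Kinvel] using RingQuot.mkAlgHom_rel Kq URel.KinvK

theorem Kel_mul_Eel : Kel * Eel = qv ^ 2 • (Eel * Kel) := by
  have h : Kel * Eel * Kinvel = qv ^ 2 • Eel := by
    simpa [Kel, Kinvel, Eel] using RingQuot.mkAlgHom_rel Kq URel.KE
  rw [← smul_mul_assoc, ← h, mul_assoc, Kinvel_mul_Kel, mul_one]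

theorem Kel_mul_Fel : Kel * Fel = qv⁻¹ ^ 2 • (Fel * Kel) := by
  have h : Kel * Fel * Kinvel = qv⁻¹ ^ 2 • Fel := by
    simpa [Kel, Kinvel, Fel] using RingQuot.mkAlgHom_rel Kq URel.KF
  rw [← smul_mul_assoc, ← h, mul_assoc, Kinvel_mul_Kel, mul_one]

theorem Eel_mul_Fel : Eel * Fel = Fel * Eel + (qv - qv⁻¹)⁻¹ • (Kel - Kinvel) := by
  rw [← sub_eq_iff_eq_add']
  simpa only [Kel, Kinvel, Fel, Eel, map_sub, map_mul, map_smul] using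
    RingQuot.mkAlgHom_rel Kq URel.EF

/-- `Kel` as a unit. -/
def Kunit : Uqˣ := ⟨Kel, Kinvel, Kel_mul_Kinvel, Kinvel_mul_Kel⟩

/-- If `K x = a x K`, then `K⁻¹ x = a⁻¹ x K⁻¹`. -/
theorem Kinvel_mul_of_Kel_mul {x : Uq} {a : Kq} (ha : a ≠ 0) (h : Kel * x = a • (x * Kel)) :
    Kinvel * x = a⁻¹ • (x * Kinvel) := by
  have h1 : Kinvel * (Kel * x) * Kinvel = a • (Kinvel * x) := by
    rw [h, mul_smul_comm, smul_mul_assoc, mul_assoc, mul_assoc, Kel_mul_Kinvel, mul_one]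
  rw [← mul_assoc, Kinvel_mul_Kel, one_mul] at h1
  rw [h1, smul_smul, inv_mul_cancel₀ ha, one_smul]

theorem Kinvel_mul_Eel : Kinvel * Eel = (qv ^ 2)⁻¹ • (Eel * Kinvel) :=
  Kinvel_mul_of_Kel_mul (pow_ne_zero _ qv_ne_zero) Kel_mul_Eel

theorem Kinvel_mul_Fel : Kinvel * Fel = (qv⁻¹ ^ 2)⁻¹ • (Fel * Kinvel) :=
  Kinvel_mul_of_Kel_mul (pow_ne_zero _ (inv_ne_zero qv_ne_zero)) Kel_mul_Fel

/-- The combination of `K` and `K⁻¹` appearing in the Casimir element. -/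
def casimirTail : Uq := casimirScalar qUnit • (qv • Kel + qv⁻¹ • Kinvel)

/-- The Casimir element of `U_q(sl(2))`. -/
def casimir : Uq := Fel * Eel + casimirTail

theorem Fel_mul_Eel : Fel * Eel = casimir - casimirTail := by simp [casimir]

theorem casimirScalar_mul : casimirScalar qUnit * (qv - qv⁻¹) = (qv - qv⁻¹)⁻¹ := by
  have := qv_sub_inv_ne_zero
  rw [casimirScalar, coe_qUnit, pow_two, mul_inv, mul_assoc, inv_mul_cancel₀ this, mul_one]

/-- The combination of `K` and `K⁻¹` by which `E F` differs from the Casimir element. -/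
def casimirTail' : Uq := casimirScalar qUnit • (qv⁻¹ • Kel + qv • Kinvel)

theorem Eel_mul_Fel' : Eel * Fel = casimir - casimirTail' := by
  have h : (qv - qv⁻¹)⁻¹ • (Kel - Kinvel) = casimirTail - casimirTail' := by
    simp only [casimirTail, casimirTail', ← casimirScalar_mul, mul_smul, sub_smul, smul_sub,
      smul_add]
    abel
  rw [Eel_mul_Fel, Fel_mul_Eel, h, sub_add_sub_cancel]

theorem casimirTail'_mul_Eel : casimirTail' * Eel = Eel * casimirTail := by
  have h1 : qv⁻¹ * qv ^ 2 = qv := by field_simp [qv_ne_zero]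
  have h2 : qv * (qv ^ 2)⁻¹ = qv⁻¹ := by field_simp [qv_ne_zero]
  simp only [casimirTail, casimirTail', smul_mul_assoc, add_mul, Kel_mul_Eel, Kinvel_mul_Eel,
    mul_smul_comm, mul_add, smul_smul, h1, h2]

theorem casimirTail_mul_Fel : casimirTail * Fel = Fel * casimirTail' := by
  have h1 : qv * qv⁻¹ ^ 2 = qv⁻¹ := by field_simp [qv_ne_zero]
  have h2 : qv⁻¹ * (qv⁻¹ ^ 2)⁻¹ = qv := by field_simp [qv_ne_zero]
  simp only [casimirTail, casimirTail', smul_mul_assoc, add_mul, Kel_mul_Fel, Kinvel_mul_Fel,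
    mul_smul_comm, mul_add, smul_smul, h1, h2]

theorem casimir_mul_Eel : casimir * Eel = Eel * casimir := by
  have h : Eel * casimir = Eel * Fel * Eel + Eel * casimirTail := by
    rw [casimir, mul_add, mul_assoc]
  rw [h, Eel_mul_Fel', sub_mul, casimirTail'_mul_Eel, sub_add_cancel]

theorem casimir_mul_Fel : casimir * Fel = Fel * casimir := by
  have h : casimir * Fel = Fel * (Eel * Fel) + casimirTail * Fel := by
    rw [casimir, add_mul, mul_assoc]
  rw [h, Eel_mul_Fel', mul_sub, casimirTail_mul_Fel, sub_add_cancel]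

theorem casimirTail_mul_Kel : casimirTail * Kel = Kel * casimirTail := by
  simp only [casimirTail, smul_mul_assoc, add_mul, mul_smul_comm, mul_add, Kel_mul_Kinvel,
    Kinvel_mul_Kel]

theorem Kel_mul_casimir : Kel * casimir = casimir * Kel := by
  have h : Kel * (Fel * Eel) = Fel * Eel * Kel := by
    have e : qv⁻¹ ^ 2 * qv ^ 2 = 1 := by field_simp [qv_ne_zero]
    rw [← mul_assoc, Kel_mul_Fel, smul_mul_assoc, mul_assoc, Kel_mul_Eel, mul_smul_comm, smul_smul,
      e, one_smul, mul_assoc]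
  rw [casimir, mul_add, add_mul, h, casimirTail_mul_Kel]

end Relations

section Span

/-- `F ^ m` for `m ≥ 0`, and `E ^ (-m)` for `m ≤ 0`. -/
def weightGen (m : ℤ) : Uq := Fel ^ m.toNat * Eel ^ (-m).toNat

theorem weightGen_natCast (n : ℕ) : weightGen n = Fel ^ n := by simp [weightGen]

theorem weightGen_neg_natCast (n : ℕ) : weightGen (-n) = Eel ^ n := by simp [weightGen]

/-- The spanning set of `U_q(sl(2))` made of products of powers of `E` or `F` with powers of `K`
and of the Casimir element. -/
def weightMonomial (g : TorusExp) : Uq :=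
  weightGen g.1 * (((Kunit ^ g.2.1 : Uqˣ) : Uq) * casimir ^ g.2.2)

theorem exists_mul_pow_eq_smul {t x : Uq} (h : ∃ a : Kq, t * x = a • (x * t)) (n : ℕ) :
    ∃ a : Kq, t * x ^ n = a • (x ^ n * t) := by
  obtain ⟨a, h⟩ := h
  induction n with
  | zero => exact ⟨1, by simp⟩
  | succ n ih =>
    obtain ⟨b, ih⟩ := ih
    refine ⟨b * a, ?_⟩
    rw [pow_succ, ← mul_assoc, ih, smul_mul_assoc, mul_assoc, h, mul_smul_comm, smul_smul,
      mul_assoc]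

theorem exists_mul_weightGen_eq_smul {t : Uq} (hE : ∃ a : Kq, t * Eel = a • (Eel * t))
    (hF : ∃ a : Kq, t * Fel = a • (Fel * t)) (m : ℤ) :
    ∃ a : Kq, t * weightGen m = a • (weightGen m * t) := by
  obtain ⟨n, rfl | rfl⟩ := m.eq_nat_or_neg
  · simpa only [weightGen_natCast] using exists_mul_pow_eq_smul hF n
  · simpa only [weightGen_neg_natCast] using exists_mul_pow_eq_smul hE n

/-- The span of the elements `weightMonomial g`. -/
def monomialSpan : Submodule Kq Uq := Submodule.span Kq (Set.range weightMonomial)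

theorem weightMonomial_mem (g : TorusExp) : weightMonomial g ∈ monomialSpan :=
  Submodule.subset_span ⟨g, rfl⟩

theorem mul_mem_monomialSpan {t : Uq} (h : ∀ g, t * weightMonomial g ∈ monomialSpan) {w : Uq}
    (hw : w ∈ monomialSpan) : t * w ∈ monomialSpan := by
  induction hw using Submodule.span_induction with
  | mem x hx => obtain ⟨g, rfl⟩ := hx; exact h g
  | zero => rw [mul_zero]; exact zero_mem _
  | add x y _ _ hx hy => rw [mul_add]; exact add_mem hx hy
  | smul a x _ hx => rw [mul_smul_comm]; exact Submodule.smul_mem _ _ hx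

theorem mul_weightMonomial_mem {t : Uq} (hE : ∃ a : Kq, t * Eel = a • (Eel * t))
    (hF : ∃ a : Kq, t * Fel = a • (Fel * t)) {g g' : TorusExp} (h1 : g.1 = g'.1)
    (h : t * (((Kunit ^ g.2.1 : Uqˣ) : Uq) * casimir ^ g.2.2) =
      ((Kunit ^ g'.2.1 : Uqˣ) : Uq) * casimir ^ g'.2.2) :
    t * weightMonomial g ∈ monomialSpan := by
  obtain ⟨a, ha⟩ := exists_mul_weightGen_eq_smul hE hF g.1
  rw [weightMonomial, ← mul_assoc, ha, smul_mul_assoc, mul_assoc, h, h1]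
  exact Submodule.smul_mem _ _ (weightMonomial_mem g')

theorem Kel_mul_mem {w : Uq} (hw : w ∈ monomialSpan) : Kel * w ∈ monomialSpan := by
  refine mul_mem_monomialSpan (fun g => mul_weightMonomial_mem ⟨_, Kel_mul_Eel⟩ ⟨_, Kel_mul_Fel⟩
    (g' := (g.1, 1 + g.2.1, g.2.2)) rfl ?_) hw
  rw [← mul_assoc, zpow_one_add]
  rfl

theorem Kinvel_mul_mem {w : Uq} (hw : w ∈ monomialSpan) : Kinvel * w ∈ monomialSpan := by
  refine mul_mem_monomialSpan (fun g => mul_weightMonomial_mem ⟨_, Kinvel_mul_Eel⟩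
    ⟨_, Kinvel_mul_Fel⟩ (g' := (g.1, -1 + g.2.1, g.2.2)) rfl ?_) hw
  rw [← mul_assoc, zpow_add, zpow_neg_one]
  rfl

theorem casimir_mul_mem {w : Uq} (hw : w ∈ monomialSpan) : casimir * w ∈ monomialSpan := by
  refine mul_mem_monomialSpan (fun g => mul_weightMonomial_mem
    ⟨1, by rw [one_smul, casimir_mul_Eel]⟩ ⟨1, by rw [one_smul, casimir_mul_Fel]⟩
    (g' := (g.1, g.2.1, g.2.2 + 1)) rfl ?_) hw
  have h : SemiconjBy casimir (Kunit : Uq) Kunit := Kel_mul_casimir.symm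
  rw [← mul_assoc, (h.units_zpow_right g.2.1).eq, mul_assoc, pow_succ']

theorem casimirTail_mul_mem {w : Uq} (hw : w ∈ monomialSpan) : casimirTail * w ∈ monomialSpan := by
  simp only [casimirTail, smul_mul_assoc, add_mul]
  exact Submodule.smul_mem _ _ (add_mem (Submodule.smul_mem _ _ (Kel_mul_mem hw))
    (Submodule.smul_mem _ _ (Kinvel_mul_mem hw)))

theorem casimirTail'_mul_mem {w : Uq} (hw : w ∈ monomialSpan) :
    casimirTail' * w ∈ monomialSpan := by
  simp only [casimirTail', smul_mul_assoc, add_mul]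
  exact Submodule.smul_mem _ _ (add_mem (Submodule.smul_mem _ _ (Kel_mul_mem hw))
    (Submodule.smul_mem _ _ (Kinvel_mul_mem hw)))

theorem Fel_mul_mem {w : Uq} (hw : w ∈ monomialSpan) : Fel * w ∈ monomialSpan := by
  refine mul_mem_monomialSpan (fun ⟨m, h⟩ => ?_) hw
  obtain ⟨n, rfl | rfl⟩ := m.eq_nat_or_neg
  · convert weightMonomial_mem (((n + 1 : ℕ) : ℤ), h) using 1
    simp only [weightMonomial, weightGen_natCast, pow_succ', mul_assoc]
  · cases n with
    | zero =>
      convert weightMonomial_mem (((1 : ℕ) : ℤ), h) using 1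
      simp only [weightMonomial, weightGen_natCast, weightGen_neg_natCast, pow_zero, pow_one,
        one_mul]
    | succ n =>
      have e : Fel * weightMonomial (-((n + 1 : ℕ) : ℤ), h) =
          casimir * weightMonomial (-(n : ℤ), h) - casimirTail * weightMonomial (-(n : ℤ), h) := by
        rw [← sub_mul, ← Fel_mul_Eel]
        simp only [weightMonomial, weightGen_neg_natCast, pow_succ', mul_assoc]
      rw [e]
      exact sub_mem (casimir_mul_mem (weightMonomial_mem _))
        (casimirTail_mul_mem (weightMonomial_mem _))

theorem Eel_mul_mem {w : Uq} (hw : w ∈ monomialSpan) : Eel * w ∈ monomialSpan := by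
  refine mul_mem_monomialSpan (fun ⟨m, h⟩ => ?_) hw
  obtain ⟨n, rfl | rfl⟩ := m.eq_nat_or_neg
  · cases n with
    | zero =>
      convert weightMonomial_mem (-((1 : ℕ) : ℤ), h) using 1
      simp only [weightMonomial, weightGen_natCast, weightGen_neg_natCast, pow_zero, pow_one,
        one_mul]
    | succ n =>
      have e : Eel * weightMonomial (((n + 1 : ℕ) : ℤ), h) =
          casimir * weightMonomial ((n : ℤ), h) - casimirTail' * weightMonomial ((n : ℤ), h) := by
        rw [← sub_mul, ← Eel_mul_Fel']
        simp only [weightMonomial, weightGen_natCast, pow_succ', mul_assoc]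
      rw [e]
      exact sub_mem (casimir_mul_mem (weightMonomial_mem _))
        (casimirTail'_mul_mem (weightMonomial_mem _))
  · convert weightMonomial_mem (-((n + 1 : ℕ) : ℤ), h) using 1
    simp only [weightMonomial, weightGen_neg_natCast, pow_succ', mul_assoc]

theorem mem_monomialSpan (u : Uq) : u ∈ monomialSpan := by
  obtain ⟨a, rfl⟩ := RingQuot.mkAlgHom_surjective Kq URel u
  have key : ∀ w ∈ monomialSpan, RingQuot.mkAlgHom Kq URel a * w ∈ monomialSpan := by
    induction a using FreeAlgebra.induction with
    | grade0 r =>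
      intro w hw
      rw [AlgHom.commutes, ← Algebra.smul_def]
      exact Submodule.smul_mem _ _ hw
    | grade1 x =>
      intro w hw
      cases x
      exacts [Eel_mul_mem hw, Fel_mul_mem hw, Kel_mul_mem hw, Kinvel_mul_mem hw]
    | mul a b ha hb =>
      intro w hw
      rw [map_mul, mul_assoc]
      exact ha _ (hb _ hw)
    | add a b ha hb =>
      intro w hw
      rw [map_add, add_mul]
      exact add_mem (ha _ hw) (hb _ hw)
  have h1 : (1 : Uq) = weightMonomial 0 := by simp [weightMonomial, weightGen]
  simpa using key 1 (h1 ▸ weightMonomial_mem 0)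

end Span

section Embedding

/-- The images of the generators of `U_q(sl(2))` in the quantum torus. -/
def torusGen : UGen → QTorus qUnit
  | .E => torusE qUnit
  | .F => torusBasis qUnit (1, 0, 0)
  | .K => torusBasis qUnit (0, 1, 0)
  | .Kinv => torusBasis qUnit (0, -1, 0)

theorem lift_torusGen_rel ⦃x y : FreeAlgebra Kq UGen⦄ (h : URel x y) :
    FreeAlgebra.lift Kq torusGen x = FreeAlgebra.lift Kq torusGen y := by
  have h0 : torusBasis qUnit (0, 0, 0) = 1 := torusBasis_zero qUnit
  cases h
  case KKinv => simp [torusGen, torusBasis_mul, torusTwist, h0]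
  case KinvK => simp [torusGen, torusBasis_mul, torusTwist, h0]
  case KE =>
    simp [torusGen, torusE, torusBasis_mul, torusTwist, mul_sub, sub_mul, mul_add, add_mul,
      coe_qUnit, smul_sub, smul_comm (qv ^ 2)]
  case KF =>
    simp [torusGen, torusBasis_mul, torusTwist, coe_qUnit]
  case EF =>
    simp only [map_sub, map_mul, map_smul, FreeAlgebra.lift_ι_apply, torusGen, torusF_mul_torusE,
      torusE_mul_torusF, coe_qUnit, ← casimirScalar_mul, mul_smul, sub_smul, smul_sub, smul_add]
    abel

/-- The embedding of `U_q(sl(2))` into the quantum torus. -/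
def toTorus : Uq →ₐ[Kq] QTorus qUnit :=
  RingQuot.liftAlgHom Kq ⟨FreeAlgebra.lift Kq torusGen, lift_torusGen_rel⟩

theorem toTorus_mk (x : UGen) :
    toTorus (RingQuot.mkAlgHom Kq URel (FreeAlgebra.ι Kq x)) = torusGen x := by
  simp [toTorus]

theorem toTorus_Eel : toTorus Eel = torusE qUnit := toTorus_mk .E

theorem toTorus_Fel : toTorus Fel = torusBasis qUnit (1, 0, 0) := toTorus_mk .F

theorem toTorus_Kel : toTorus Kel = torusBasis qUnit (0, 1, 0) := toTorus_mk .K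

theorem toTorus_Kinvel : toTorus Kinvel = torusBasis qUnit (0, -1, 0) := toTorus_mk .Kinv

theorem toTorus_casimir : toTorus casimir = torusBasis qUnit (0, 0, 1) := by
  rw [casimir, casimirTail, map_add, map_mul, map_smul, map_add, map_smul, map_smul, toTorus_Eel,
    toTorus_Fel, toTorus_Kel, toTorus_Kinvel, torusF_mul_torusE, coe_qUnit, sub_add_cancel]

theorem toTorus_zpow (j : ℤ) :
    toTorus ((Kunit ^ j : Uqˣ) : Uq) = torusBasis qUnit (0, j, 0) := by
  induction j with
  | zero =>
    rw [zpow_zero, Units.val_one, map_one]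
    exact (torusBasis_zero qUnit).symm
  | succ n ih =>
    have h : toTorus (Kunit : Uq) = torusBasis qUnit (0, 1, 0) := toTorus_Kel
    rw [zpow_add_one, Units.val_mul, map_mul, ih, h, torusBasis_mul]
    simp [torusTwist]
  | pred n ih =>
    have h : toTorus ((Kunit⁻¹ : Uqˣ) : Uq) = torusBasis qUnit (0, -1, 0) := toTorus_Kinvel
    rw [zpow_sub_one, Units.val_mul, map_mul, ih, h, torusBasis_mul]
    simp [torusTwist, sub_eq_add_neg]

theorem toTorus_casimir_pow (l : ℕ) : toTorus (casimir ^ l) = torusBasis qUnit (0, 0, l) := by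
  induction l with
  | zero =>
    rw [pow_zero, map_one]
    exact (torusBasis_zero qUnit).symm
  | succ n ih =>
    rw [pow_succ, map_mul, ih, toTorus_casimir, torusBasis_mul]
    simp [torusTwist]

theorem toTorus_weightMonomial (g : TorusExp) :
    toTorus (weightMonomial g) = toTorus (weightGen g.1) * torusBasis qUnit (0, g.2) := by
  rw [weightMonomial, map_mul, map_mul, toTorus_zpow, toTorus_casimir_pow, torusBasis_mul]
  simp [torusTwist]

theorem toTorus_weightGen_mem (m : ℤ) : toTorus (weightGen m) ∈ torusWeight qUnit m := by
  obtain ⟨n, rfl | rfl⟩ := m.eq_nat_or_neg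
  · rw [weightGen_natCast, map_pow, toTorus_Fel]
    simpa using pow_mem_torusWeight qUnit (torusBasis_mem_torusWeight qUnit (1, 0, 0)) n
  · rw [weightGen_neg_natCast, map_pow, toTorus_Eel]
    simpa using pow_mem_torusWeight qUnit (torusE_mem_torusWeight qUnit) n

instance nontrivial_qTorus : Nontrivial (QTorus qUnit) := ⟨_, _, torusE_ne_zero qUnit⟩

theorem toTorus_weightGen_ne_zero (m : ℤ) : toTorus (weightGen m) ≠ 0 := by
  rw [weightGen, map_mul, map_pow, map_pow, toTorus_Fel, toTorus_Eel]
  exact mul_ne_zero (pow_ne_zero _ ((torusBasis qUnit).ne_zero _))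
    (pow_ne_zero _ (torusE_ne_zero qUnit))

theorem toTorus_injective : Function.Injective toTorus := by
  rw [injective_iff_map_eq_zero]
  intro u hu
  obtain ⟨f, rfl⟩ := Finsupp.mem_span_range_iff_exists_finsupp.1 (mem_monomialSpan u)
  have hli := linearIndependent_weight_mul qUnit toTorus_weightGen_mem toTorus_weightGen_ne_zero
  have hf : f = 0 := by
    refine linearIndependent_iff.1 hli f ?_
    rw [Finsupp.linearCombination_apply, ← hu, Finsupp.sum, Finsupp.sum, map_sum]
    simp only [map_smul, toTorus_weightMonomial]
  rw [hf, Finsupp.sum_zero_index]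

end Embedding

theorem noZeroDivisors_Uq : NoZeroDivisors Uq :=
  toTorus_injective.noZeroDivisors _ (map_zero _) (map_mul _)

theorem noZeroDivisors_tensorProduct_Uq (A : Type*) [Ring A] [Algebra Kq A] [NoZeroDivisors A] :
    NoZeroDivisors (A ⊗[Kq] Uq) :=
  have h : Function.Injective (Algebra.TensorProduct.map (AlgHom.id Kq A) toTorus) :=
    Module.Flat.lTensor_preserves_injective_linearMap toTorus.toLinearMap toTorus_injective
  h.noZeroDivisors _ (map_zero _) (map_mul _)

theorem noZeroDivisors_Tpow (m : ℕ) : NoZeroDivisors (Tpow m) := by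
  induction m with
  | zero => exact noZeroDivisors_Uq
  | succ n ih => exact noZeroDivisors_tensorProduct_Uq (Tpow n)

/-- For every `n ≥ 1` (here `n = m + 1`), the `ℂ(q)`-algebra `U_q^{⊗n}` has no
nontrivial zero divisors. -/
theorem statement9 (m : ℕ) (x y : Tpow m) (h : x * y = 0) : x = 0 ∨ y = 0 := by
  have := noZeroDivisors_Tpow m
  exact mul_eq_zero.1 h
end
end

section
/- The center of 𝒜_ε is the subalgebra generated by ω, b^l, c^l and d^l; moreover the kernel of the ℂ-algebra homomorphism ℂ[W, B, C, D] → 𝒜_ε sending W, B, C, D respectively to ω, b^l, c^l, d^l is the ideal generated by (T_l(W) - D)D - BC - 1, so the center of 𝒜_ε is isomorphic to ℂ[W, B, C, D]/((T_l(W) - D)D - BC - 1). -/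
noncomputable section

/-- Generators `a`, `b`, `c`, `d` of the algebra `𝒜_ε = ℒ^ε_{0,1}(sl(2))`. -/
inductive AGen : Type
  | a | b | c | d

/-- The defining relations of `𝒜_ε = ℒ^ε_{0,1}(sl(2))`, the specialization at `q = ε`. -/
inductive AeRel (ε : ℂ) : FreeAlgebra ℂ AGen → FreeAlgebra ℂ AGen → Prop
  | ad_comm : AeRel ε (FreeAlgebra.ι ℂ AGen.a * FreeAlgebra.ι ℂ AGen.d)
      (FreeAlgebra.ι ℂ AGen.d * FreeAlgebra.ι ℂ AGen.a)
  | db : AeRel ε (FreeAlgebra.ι ℂ AGen.d * FreeAlgebra.ι ℂ AGen.b)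
      ((ε ^ 2) • (FreeAlgebra.ι ℂ AGen.b * FreeAlgebra.ι ℂ AGen.d))
  | cd : AeRel ε (FreeAlgebra.ι ℂ AGen.c * FreeAlgebra.ι ℂ AGen.d)
      ((ε ^ 2) • (FreeAlgebra.ι ℂ AGen.d * FreeAlgebra.ι ℂ AGen.c))
  | ab : AeRel ε (FreeAlgebra.ι ℂ AGen.a * FreeAlgebra.ι ℂ AGen.b
        - FreeAlgebra.ι ℂ AGen.b * FreeAlgebra.ι ℂ AGen.a)
      ((-(1 - ε⁻¹ ^ 2)) • (FreeAlgebra.ι ℂ AGen.b * FreeAlgebra.ι ℂ AGen.d))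
  | cb : AeRel ε (FreeAlgebra.ι ℂ AGen.c * FreeAlgebra.ι ℂ AGen.b
        - FreeAlgebra.ι ℂ AGen.b * FreeAlgebra.ι ℂ AGen.c)
      ((1 - ε⁻¹ ^ 2) • (FreeAlgebra.ι ℂ AGen.d * FreeAlgebra.ι ℂ AGen.a
        - FreeAlgebra.ι ℂ AGen.d * FreeAlgebra.ι ℂ AGen.d))
  | ac : AeRel ε (FreeAlgebra.ι ℂ AGen.a * FreeAlgebra.ι ℂ AGen.c
        - FreeAlgebra.ι ℂ AGen.c * FreeAlgebra.ι ℂ AGen.a)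
      ((1 - ε⁻¹ ^ 2) • (FreeAlgebra.ι ℂ AGen.d * FreeAlgebra.ι ℂ AGen.c))
  | det : AeRel ε (FreeAlgebra.ι ℂ AGen.a * FreeAlgebra.ι ℂ AGen.d
        - (ε ^ 2) • (FreeAlgebra.ι ℂ AGen.b * FreeAlgebra.ι ℂ AGen.c)) 1

/-- The algebra `𝒜_ε = ℒ^ε_{0,1}(sl(2))`, presented by generators and relations. -/
abbrev Ae (ε : ℂ) : Type := RingQuot (AeRel ε)

noncomputable def aE (ε : ℂ) : Ae ε := RingQuot.mkAlgHom ℂ (AeRel ε) (FreeAlgebra.ι ℂ AGen.a)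
noncomputable def bE (ε : ℂ) : Ae ε := RingQuot.mkAlgHom ℂ (AeRel ε) (FreeAlgebra.ι ℂ AGen.b)
noncomputable def cE (ε : ℂ) : Ae ε := RingQuot.mkAlgHom ℂ (AeRel ε) (FreeAlgebra.ι ℂ AGen.c)
noncomputable def dE (ε : ℂ) : Ae ε := RingQuot.mkAlgHom ℂ (AeRel ε) (FreeAlgebra.ι ℂ AGen.d)

/-- The element `ω = ε a + ε⁻¹ d`. -/
noncomputable def ωE (ε : ℂ) : Ae ε := ε • aE ε + ε⁻¹ • dE ε

/-- The normalized Chebyshev polynomials: `T 0 = 2`, `T 1 = X`,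
`T (k+2) = X * T (k+1) - T k`. -/
noncomputable def Tpol : ℕ → Polynomial ℂ
  | 0 => 2
  | 1 => Polynomial.X
  | k + 2 => Polynomial.X * Tpol (k + 1) - Tpol k

/-- The generator `(T_l(W) - D)·D - B·C - 1` of the relation ideal, as a polynomial in
`ℂ[W, B, C, D] = MvPolynomial (Fin 4) ℂ`, with `W = X 0`, `B = X 1`, `C = X 2`, `D = X 3`. -/
noncomputable def relCenter (l : ℕ) : MvPolynomial (Fin 4) ℂ :=
  (Polynomial.aeval (MvPolynomial.X 0 : MvPolynomial (Fin 4) ℂ) (Tpol l)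
      - MvPolynomial.X 3) * MvPolynomial.X 3
    - MvPolynomial.X 1 * MvPolynomial.X 2 - 1


open Polynomial in
/-- The substitution `D ↦ t D` on `ℂ[W][D]`. -/
def scaleVar (t : ℂ) : ℂ[X][X] →ₐ[ℂ[X]] ℂ[X][X] := aeval (C (C t) * X)

open Polynomial in
/-- The polynomial `P(W, D)` with `b c = P(ω, d)`. -/
def bcPoly (ε : ℂ) : ℂ[X][X] :=
  C (C (ε⁻¹ ^ 3) * X) * X - C (C (ε⁻¹ ^ 4)) * X ^ 2 - C (C (ε⁻¹ ^ 2))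

open Polynomial in
/-- The polynomial `Q(W, D)` with `c b = Q(ω, d)`. -/
def cbPoly (ε : ℂ) : ℂ[X][X] := C (C ε⁻¹ * X) * X - X ^ 2 - C (C (ε⁻¹ ^ 2))

/-- The normal form coefficient of `b * u (n - 1)`, where `u n` is `b ^ n` or `c ^ (-n)`. -/
def raiseCoeff (ε : ℂ) (n : ℤ) : Polynomial (Polynomial ℂ) := if 1 ≤ n then 1 else bcPoly ε

/-- The normal form coefficient of `c * u (n + 1)`, where `u n` is `b ^ n` or `c ^ (-n)`. -/
def lowerCoeff (ε : ℂ) (n : ℤ) : Polynomial (Polynomial ℂ) := if n ≤ -1 then 1 else cbPoly ε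

namespace Ae

open Polynomial

section Scale

@[simp] lemma scaleVar_X (t : ℂ) : scaleVar t X = C (C t) * X := by simp [scaleVar]

@[simp] lemma scaleVar_C (t : ℂ) (p : ℂ[X]) : scaleVar t (C p) = C p :=
  (scaleVar t).commutes p

lemma scaleVar_scaleVar (s t : ℂ) (r : ℂ[X][X]) :
    scaleVar s (scaleVar t r) = scaleVar (s * t) r := by
  have : (scaleVar s).comp (scaleVar t) = scaleVar (s * t) := by
    ext1
    simp only [AlgHom.comp_apply, scaleVar_X, map_mul, scaleVar_C]
    ring
  exact DFunLike.congr_fun this r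

@[simp] lemma scaleVar_one (r : ℂ[X][X]) : scaleVar 1 r = r := by
  have : scaleVar 1 = AlgHom.id ℂ[X] _ := by ext1; simp
  exact DFunLike.congr_fun this r

lemma coeff_scaleVar (t : ℂ) (r : ℂ[X][X]) (j : ℕ) :
    (scaleVar t r).coeff j = C (t ^ j) * r.coeff j := by
  have : scaleVar t r = r.comp (C (C t) * X) := rfl
  rw [this, comp_C_mul_X_coeff, ← C_pow, mul_comm]

lemma scaleVar_X_pow {t : ℂ} {k : ℕ} (ht : t ^ k = 1) :
    scaleVar t (X ^ k) = X ^ k := by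
  rw [map_pow, scaleVar_X, mul_pow, ← C_pow, ← C_pow, ht, C_1, C_1, one_mul]

lemma smul_eq_C_mul (z : ℂ) (r : ℂ[X][X]) : z • r = C (C z) * r := by
  rw [Algebra.smul_def]; rfl

lemma scaleVar_smul (t z : ℂ) (r : ℂ[X][X]) : scaleVar t (z • r) = z • scaleVar t r := by
  rw [smul_eq_C_mul, smul_eq_C_mul, map_mul, scaleVar_C]

variable {ε : ℂ}

lemma scaleVar_bcPoly (h : ε ≠ 0) : scaleVar (ε ^ 2) (bcPoly ε) = cbPoly ε := by
  simp only [bcPoly, cbPoly, map_sub, map_mul, map_pow, scaleVar_X, scaleVar_C]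
  have : (C (C ε⁻¹) * C (C ε) : ℂ[X][X]) = 1 := by
    rw [← C_mul, ← C_mul, inv_mul_cancel₀ h, C_1, C_1]
  linear_combination (C X * X * C (C ε⁻¹) * (C (C ε⁻¹) * C (C ε) + 1) -
    X ^ 2 * (C (C ε⁻¹) ^ 3 * C (C ε) ^ 3 + C (C ε⁻¹) ^ 2 * C (C ε) ^ 2 + C (C ε⁻¹) * C (C ε) + 1)) *
      this

lemma scaleVar_cbPoly (h : ε ≠ 0) : scaleVar (ε⁻¹ ^ 2) (cbPoly ε) = bcPoly ε := by
  rw [← scaleVar_bcPoly h, scaleVar_scaleVar, ← mul_pow, inv_mul_cancel₀ h, one_pow, scaleVar_one]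

lemma bcPoly_ne_zero (h : ε ≠ 0) : bcPoly ε ≠ 0 := by
  intro H
  have := congrArg (fun p => (coeff p 0).coeff 0) H
  simp [bcPoly, h] at this

end Scale

section Model

/-- Multiplication by `b` in terms of normal forms. -/
def raiseOp (ε : ℂ) : Module.End ℂ (ℤ → ℂ[X][X]) where
  toFun f n := raiseCoeff ε n * scaleVar (ε⁻¹ ^ 2) (f (n - 1))
  map_add' f g := by ext1 n; simp [mul_add]
  map_smul' z f := by ext1 n; simp [scaleVar_smul]

/-- Multiplication by `c` in terms of normal forms. -/
def lowerOp (ε : ℂ) : Module.End ℂ (ℤ → ℂ[X][X]) where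
  toFun f n := lowerCoeff ε n * scaleVar (ε ^ 2) (f (n + 1))
  map_add' f g := by ext1 n; simp [mul_add]
  map_smul' z f := by ext1 n; simp [scaleVar_smul]

/-- The images of the generators under the normal form representation. -/
def genOp (ε : ℂ) : AGen → Module.End ℂ (ℤ → ℂ[X][X])
  | .a => Algebra.lsmul ℂ ℂ _ (C (C ε⁻¹ * X) - C (C (ε⁻¹ ^ 2)) * X : ℂ[X][X])
  | .b => raiseOp ε
  | .c => lowerOp ε
  | .d => Algebra.lsmul ℂ ℂ _ (X : ℂ[X][X])

variable {ε : ℂ}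

lemma scaleVar_inv_scaleVar (h : ε ≠ 0) (r : ℂ[X][X]) :
    scaleVar (ε⁻¹ ^ 2) (scaleVar (ε ^ 2) r) = r := by
  rw [scaleVar_scaleVar, ← mul_pow, inv_mul_cancel₀ h, one_pow, scaleVar_one]

lemma scaleVar_scaleVar_inv (h : ε ≠ 0) (r : ℂ[X][X]) :
    scaleVar (ε ^ 2) (scaleVar (ε⁻¹ ^ 2) r) = r := by
  rw [scaleVar_scaleVar, ← mul_pow, mul_inv_cancel₀ h, one_pow, scaleVar_one]

lemma raise_lower (h : ε ≠ 0) (f : ℤ → ℂ[X][X]) (n : ℤ) :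
    raiseOp ε (lowerOp ε f) n = bcPoly ε * f n := by
  simp only [raiseOp, lowerOp, LinearMap.coe_mk, AddHom.coe_mk, map_mul, scaleVar_inv_scaleVar h,
    sub_add_cancel, raiseCoeff, lowerCoeff]
  by_cases hn : 1 ≤ n
  · rw [if_pos hn, if_neg (by omega), scaleVar_cbPoly h, one_mul]
  · rw [if_neg hn, if_pos (by omega), map_one, one_mul]

lemma lower_raise (h : ε ≠ 0) (f : ℤ → ℂ[X][X]) (n : ℤ) :
    lowerOp ε (raiseOp ε f) n = cbPoly ε * f n := by
  simp only [raiseOp, lowerOp, LinearMap.coe_mk, AddHom.coe_mk, map_mul, scaleVar_scaleVar_inv h,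
    add_sub_cancel_right, raiseCoeff, lowerCoeff]
  by_cases hn : n ≤ -1
  · rw [if_pos hn, if_neg (by omega), scaleVar_bcPoly h, one_mul]
  · rw [if_neg hn, if_pos (by omega), map_one, one_mul]

lemma genOp_rel (h : ε ≠ 0) ⦃x y : FreeAlgebra ℂ AGen⦄ (hxy : AeRel ε x y) :
    FreeAlgebra.lift ℂ (genOp ε) x = FreeAlgebra.lift ℂ (genOp ε) y := by
  have hu : (C (C ε) * C (C ε⁻¹) : ℂ[X][X]) = 1 := by
    rw [← C_mul, ← C_mul, mul_inv_cancel₀ h, C_1, C_1]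
  refine LinearMap.ext fun f => funext fun n => ?_
  cases hxy <;>
    simp only [map_mul, map_sub, map_smul, map_one, FreeAlgebra.lift_ι_apply, genOp,
      Module.End.mul_apply, LinearMap.sub_apply, LinearMap.smul_apply, Pi.sub_apply, Pi.smul_apply,
      Algebra.lsmul_coe, smul_eq_mul, smul_eq_C_mul, raise_lower h, lower_raise h,
      Module.End.one_apply]
  case ad_comm => ring
  case det =>
    simp only [bcPoly, map_mul, map_pow]
    linear_combination (C (C ε) * C (C ε⁻¹) + 1) *
      (1 - C (C ε⁻¹) * C X * X + C (C ε⁻¹) ^ 2 * X ^ 2) * f n * hu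
  case cb =>
    simp only [bcPoly, cbPoly, map_mul, map_pow]
    ring
  all_goals
    simp only [raiseOp, lowerOp, LinearMap.coe_mk, AddHom.coe_mk, Pi.smul_apply, smul_eq_mul,
      map_mul, map_sub, map_pow, map_one, map_neg, scaleVar_X, scaleVar_C]
  case db =>
    linear_combination (-(C (C ε) * C (C ε⁻¹) + 1) * X * raiseCoeff ε n *
      scaleVar (ε⁻¹ ^ 2) (f (n - 1))) * hu
  case ab => ring
  case cd => ring
  case ac =>
    linear_combination ((C (C ε) * C (C ε⁻¹) + 1) * X * lowerCoeff ε n *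
      scaleVar (ε ^ 2) (f (n + 1))) * hu

end Model

section Relations

variable (ε : ℂ)

lemma aE_mul_dE : aE ε * dE ε = dE ε * aE ε := by
  simpa [aE, dE] using RingQuot.mkAlgHom_rel ℂ (AeRel.ad_comm (ε := ε))

lemma dE_mul_bE : dE ε * bE ε = ε ^ 2 • (bE ε * dE ε) := by
  simpa only [map_mul, map_smul, aE, bE, cE, dE] using RingQuot.mkAlgHom_rel ℂ (AeRel.db (ε := ε))

lemma cE_mul_dE : cE ε * dE ε = ε ^ 2 • (dE ε * cE ε) := by
  simpa only [map_mul, map_smul, aE, bE, cE, dE] using RingQuot.mkAlgHom_rel ℂ (AeRel.cd (ε := ε))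

lemma aE_mul_bE : aE ε * bE ε - bE ε * aE ε = (-(1 - ε⁻¹ ^ 2)) • (bE ε * dE ε) := by
  simpa only [map_mul, map_smul, map_sub, aE, bE, cE, dE] using
    RingQuot.mkAlgHom_rel ℂ (AeRel.ab (ε := ε))

lemma cE_mul_bE :
    cE ε * bE ε - bE ε * cE ε = (1 - ε⁻¹ ^ 2) • (dE ε * aE ε - dE ε * dE ε) := by
  simpa only [map_mul, map_smul, map_sub, aE, bE, cE, dE] using
    RingQuot.mkAlgHom_rel ℂ (AeRel.cb (ε := ε))

lemma aE_mul_cE : aE ε * cE ε - cE ε * aE ε = (1 - ε⁻¹ ^ 2) • (dE ε * cE ε) := by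
  simpa only [map_mul, map_smul, map_sub, aE, bE, cE, dE] using
    RingQuot.mkAlgHom_rel ℂ (AeRel.ac (ε := ε))

lemma det_eq_one : aE ε * dE ε - ε ^ 2 • (bE ε * cE ε) = 1 := by
  simpa only [map_mul, map_smul, map_sub, map_one, aE, bE, cE, dE] using
    RingQuot.mkAlgHom_rel ℂ (AeRel.det (ε := ε))

variable {ε}

lemma aE_eq (h : ε ≠ 0) : aE ε = ε⁻¹ • ωE ε - ε⁻¹ ^ 2 • dE ε := by
  simp only [ωE]
  match_scalars <;> field_simp
  ring

lemma induction_on (h : ε ≠ 0) {motive : Ae ε → Prop} (x : Ae ε)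
    (scalar : ∀ z : ℂ, motive (algebraMap ℂ _ z)) (omega : motive (ωE ε)) (b : motive (bE ε))
    (c : motive (cE ε)) (d : motive (dE ε)) (mul : ∀ x y, motive x → motive y → motive (x * y))
    (add : ∀ x y, motive x → motive y → motive (x + y)) : motive x := by
  obtain ⟨x, rfl⟩ := RingQuot.mkAlgHom_surjective ℂ (AeRel ε) x
  induction x using FreeAlgebra.induction with
  | grade0 z => simpa using scalar z
  | grade1 g =>
    cases g with
    | a =>
      have : aE ε = algebraMap ℂ _ ε⁻¹ * ωE ε + algebraMap ℂ _ (-ε⁻¹ ^ 2) * dE ε := by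
        rw [aE_eq h, ← Algebra.smul_def, ← Algebra.smul_def]
        module
      change motive (aE ε)
      rw [this]
      exact add _ _ (mul _ _ (scalar _) omega) (mul _ _ (scalar _) d)
    | b => exact b
    | c => exact c
    | d => exact d
  | mul x y hx hy => rw [map_mul]; exact mul _ _ hx hy
  | add x y hx hy => rw [map_add]; exact add _ _ hx hy

lemma mem_center (h : ε ≠ 0) {x : Ae ε} (omega : Commute x (ωE ε)) (b : Commute x (bE ε))
    (c : Commute x (cE ε)) (d : Commute x (dE ε)) : x ∈ Subalgebra.center ℂ (Ae ε) := by
  rw [Subalgebra.mem_center_iff]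
  intro y
  suffices Commute x y from this.eq.symm
  induction y using induction_on h with
  | scalar z => exact (Algebra.commutes z x).symm
  | omega => exact omega
  | b => exact b
  | c => exact c
  | d => exact d
  | mul y z hy hz => exact hy.mul_right hz
  | add y z hy hz => exact hy.add_right hz

lemma omega_comm_dE : Commute (ωE ε) (dE ε) := by
  simp only [Commute, SemiconjBy, ωE, add_mul, mul_add, smul_mul_assoc, mul_smul_comm, aE_mul_dE]

lemma omega_comm_bE (h : ε ≠ 0) : Commute (ωE ε) (bE ε) := by
  simp only [Commute, SemiconjBy, ωE, add_mul, mul_add, smul_mul_assoc, mul_smul_comm,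
    eq_add_of_sub_eq (aE_mul_bE ε), dE_mul_bE]
  match_scalars <;> field_simp
  ring

lemma omega_comm_cE (h : ε ≠ 0) : Commute (ωE ε) (cE ε) := by
  simp only [Commute, SemiconjBy, ωE, add_mul, mul_add, smul_mul_assoc, mul_smul_comm,
    eq_add_of_sub_eq (aE_mul_cE ε), cE_mul_dE]
  match_scalars <;> field_simp
  ring

lemma omega_mem_center (h : ε ≠ 0) : ωE ε ∈ Subalgebra.center ℂ (Ae ε) :=
  mem_center h (Commute.refl _) (omega_comm_bE h) (omega_comm_cE h) omega_comm_dE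

end Relations

section CoeffHom

variable {ε : ℂ}

lemma aeval_omega_comm {y : Ae ε} (hy : Commute (ωE ε) y) (p : ℂ[X]) :
    Commute (aeval (ωE ε) p) y := by
  have hle : Algebra.adjoin ℂ {ωE ε} ≤ Subalgebra.centralizer ℂ {y} :=
    Algebra.adjoin_le (by
      simpa [Set.mem_centralizer_iff] using hy.eq.symm)
  have := hle (aeval_mem_adjoin_singleton ℂ (ωE ε) (p := p))
  exact ((Subalgebra.mem_centralizer_iff ℂ).1 this y rfl).symm

variable (ε) in
/-- The homomorphism `ℂ[W][D] → 𝒜_ε` sending `W` to `ω` and `D` to `d`. -/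
def coeffHom : ℂ[X][X] →+* Ae ε :=
  eval₂RingHom' (aeval (ωE ε) : ℂ[X] →ₐ[ℂ] Ae ε).toRingHom (dE ε)
    (aeval_omega_comm omega_comm_dE)

@[simp] lemma coeffHom_X : coeffHom ε X = dE ε := eval₂_X _ _

@[simp] lemma coeffHom_C (p : ℂ[X]) : coeffHom ε (C p) = aeval (ωE ε) p := eval₂_C _ _

lemma bE_mul_dE (h : ε ≠ 0) : bE ε * dE ε = ε⁻¹ ^ 2 • (dE ε * bE ε) := by
  rw [dE_mul_bE, smul_smul, ← mul_pow, inv_mul_cancel₀ h, one_pow, one_smul]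

lemma mul_coeffHom {y : Ae ε} {t : ℂ} (hω : Commute (ωE ε) y)
    (hd : y * dE ε = t • (dE ε * y)) (r : ℂ[X][X]) :
    y * coeffHom ε r = coeffHom ε (scaleVar t r) * y := by
  induction r using Polynomial.induction_on with
  | C p => simpa using (aeval_omega_comm hω p).eq.symm
  | add p q hp hq => simp only [map_add, mul_add, add_mul, hp, hq]
  | monomial n p ih =>
    rw [pow_succ, ← mul_assoc, map_mul, ← mul_assoc, ih, map_mul (scaleVar t) _ X, scaleVar_X,
      map_mul (coeffHom ε) _ (C (C t) * X), mul_assoc, coeffHom_X, hd, mul_assoc,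
      map_mul (coeffHom ε) (C (C t)), coeffHom_C, aeval_C, coeffHom_X, mul_assoc,
      ← Algebra.smul_def]

lemma bE_pow_mul_coeffHom (h : ε ≠ 0) (k : ℕ) (r : ℂ[X][X]) :
    bE ε ^ k * coeffHom ε r = coeffHom ε (scaleVar ((ε⁻¹ ^ 2) ^ k) r) * bE ε ^ k := by
  induction k with
  | zero => simp
  | succ k ih =>
    rw [pow_succ', mul_assoc, ih, ← mul_assoc, mul_coeffHom (omega_comm_bE h) (bE_mul_dE h),
      mul_assoc, scaleVar_scaleVar, ← pow_succ', ← pow_succ']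

lemma cE_pow_mul_coeffHom (h : ε ≠ 0) (k : ℕ) (r : ℂ[X][X]) :
    cE ε ^ k * coeffHom ε r = coeffHom ε (scaleVar ((ε ^ 2) ^ k) r) * cE ε ^ k := by
  induction k with
  | zero => simp
  | succ k ih =>
    rw [pow_succ', mul_assoc, ih, ← mul_assoc, mul_coeffHom (omega_comm_cE h) (cE_mul_dE ε),
      mul_assoc, scaleVar_scaleVar, ← pow_succ', ← pow_succ']

lemma bE_mul_cE (h : ε ≠ 0) : bE ε * cE ε = coeffHom ε (bcPoly ε) := by
  have h1 : bE ε * cE ε = ε⁻¹ ^ 2 • (aE ε * dE ε - 1) := by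
    rw [← det_eq_one ε, sub_sub_cancel, smul_smul, ← mul_pow, inv_mul_cancel₀ h, one_pow, one_smul]
  rw [h1, aE_eq h]
  simp only [bcPoly, pow_two (X : ℂ[X][X]), map_sub, map_mul, coeffHom_X, coeffHom_C, aeval_C,
    aeval_X, sub_mul, smul_mul_assoc, ← Algebra.smul_def]
  simp only [Algebra.algebraMap_eq_smul_one]
  module

lemma cE_mul_bE_eq (h : ε ≠ 0) : cE ε * bE ε = coeffHom ε (cbPoly ε) := by
  have h1 : bE ε * cE ε = ε⁻¹ ^ 2 • (aE ε * dE ε - 1) := by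
    rw [← det_eq_one ε, sub_sub_cancel, smul_smul, ← mul_pow, inv_mul_cancel₀ h, one_pow, one_smul]
  rw [eq_add_of_sub_eq (cE_mul_bE ε), h1, ← aE_mul_dE, aE_eq h]
  simp only [cbPoly, pow_two (X : ℂ[X][X]), map_sub, map_mul, coeffHom_X, coeffHom_C, aeval_C,
    aeval_X, sub_mul, smul_mul_assoc, ← Algebra.smul_def]
  simp only [Algebra.algebraMap_eq_smul_one]
  match_scalars <;> field_simp <;> ring

end CoeffHom

section NormalForm

variable {ε : ℂ}

/-- The representation of `𝒜_ε` on normal forms. -/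
def nfRep (h : ε ≠ 0) : Ae ε →ₐ[ℂ] Module.End ℂ (ℤ → ℂ[X][X]) :=
  RingQuot.liftAlgHom ℂ ⟨FreeAlgebra.lift ℂ (genOp ε), genOp_rel h⟩

lemma nfRep_gen (h : ε ≠ 0) (g : AGen) :
    nfRep h (RingQuot.mkAlgHom ℂ (AeRel ε) (FreeAlgebra.ι ℂ g)) = genOp ε g := by
  rw [nfRep, RingQuot.liftAlgHom_mkAlgHom_apply, FreeAlgebra.lift_ι_apply]

lemma nfRep_bE (h : ε ≠ 0) : nfRep h (bE ε) = raiseOp ε := nfRep_gen h _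

lemma nfRep_cE (h : ε ≠ 0) : nfRep h (cE ε) = lowerOp ε := nfRep_gen h _

lemma nfRep_dE (h : ε ≠ 0) : nfRep h (dE ε) = Algebra.lsmul ℂ ℂ _ (X : ℂ[X][X]) := nfRep_gen h _

lemma nfRep_ωE (h : ε ≠ 0) : nfRep h (ωE ε) = Algebra.lsmul ℂ ℂ _ (C X : ℂ[X][X]) := by
  have ha : nfRep h (aE ε) = Algebra.lsmul ℂ ℂ _
      (C (C ε⁻¹ * X) - C (C (ε⁻¹ ^ 2)) * X : ℂ[X][X]) := nfRep_gen h _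
  have hu : (C (C ε) * C (C ε⁻¹) : ℂ[X][X]) = 1 := by
    rw [← C_mul, ← C_mul, mul_inv_cancel₀ h, C_1, C_1]
  rw [ωE, map_add, map_smul, map_smul, ha, nfRep_dE, ← map_smul, ← map_smul, ← map_add,
    smul_eq_C_mul, smul_eq_C_mul]
  congr 1
  simp only [map_mul, map_pow]
  linear_combination (C X - C (C ε⁻¹) * X) * hu

lemma nfRep_coeffHom (h : ε ≠ 0) (r : ℂ[X][X]) :
    nfRep h (coeffHom ε r) = Algebra.lsmul ℂ ℂ _ r := by
  suffices (nfRep h : Ae ε →+* _).comp (coeffHom ε) =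
      (Algebra.lsmul ℂ ℂ (ℤ → ℂ[X][X]) : ℂ[X][X] →ₐ[ℂ] _).toRingHom from DFunLike.congr_fun this r
  refine ringHom_ext' (ringHom_ext (fun z => ?_) ?_) ?_
  · change nfRep h (coeffHom ε (C (C z))) = Algebra.lsmul ℂ ℂ _ (algebraMap ℂ ℂ[X][X] z)
    rw [coeffHom_C, aeval_C, AlgHom.commutes, AlgHom.commutes]
  · simp [nfRep_ωE]
  · simp [nfRep_dE]

/-- The coefficients of the normal form of an element of `𝒜_ε`. -/
def nfCoeff (h : ε ≠ 0) (x : Ae ε) : ℤ → ℂ[X][X] := nfRep h x (Pi.single 0 1)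

lemma nfCoeff_mul (h : ε ≠ 0) (x y : Ae ε) : nfCoeff h (x * y) = nfRep h x (nfCoeff h y) := by
  simp [nfCoeff]

lemma nfCoeff_coeffHom_mul (h : ε ≠ 0) (r : ℂ[X][X]) (x : Ae ε) :
    nfCoeff h (coeffHom ε r * x) = r • nfCoeff h x := by
  rw [nfCoeff_mul, nfRep_coeffHom, Algebra.lsmul_coe]

variable (ε) in
/-- `b ^ n` for `0 ≤ n` and `c ^ (-n)` for `n ≤ 0`. -/
def signedPow (n : ℤ) : Ae ε := if 0 ≤ n then bE ε ^ n.toNat else cE ε ^ (-n).toNat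

@[simp] lemma signedPow_natCast (k : ℕ) : signedPow ε k = bE ε ^ k := by simp [signedPow]

@[simp] lemma signedPow_neg (k : ℕ) : signedPow ε (-k) = cE ε ^ k := by
  rcases k.eq_zero_or_pos with rfl | hk
  · simp [signedPow]
  · rw [signedPow, if_neg (by omega), neg_neg, Int.toNat_natCast]

lemma bE_mul_signedPow (h : ε ≠ 0) (n : ℤ) :
    bE ε * signedPow ε n = coeffHom ε (raiseCoeff ε (n + 1)) * signedPow ε (n + 1) := by
  by_cases hn : 0 ≤ n
  · lift n to ℕ using hn
    rw [raiseCoeff, if_pos (by omega), map_one, one_mul, ← Nat.cast_succ, signedPow_natCast,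
      signedPow_natCast, pow_succ']
  · obtain ⟨k, rfl⟩ : ∃ k : ℕ, n = -(k + 1 : ℕ) := ⟨(-n - 1).toNat, by omega⟩
    rw [raiseCoeff, if_neg (by omega), show -((k + 1 : ℕ) : ℤ) + 1 = -k by push_cast; ring,
      signedPow_neg, signedPow_neg, pow_succ', ← mul_assoc, bE_mul_cE h]

lemma cE_mul_signedPow (h : ε ≠ 0) (n : ℤ) :
    cE ε * signedPow ε n = coeffHom ε (lowerCoeff ε (n - 1)) * signedPow ε (n - 1) := by
  by_cases hn : n ≤ 0
  · obtain ⟨k, rfl⟩ : ∃ k : ℕ, n = -(k : ℕ) := ⟨(-n).toNat, by omega⟩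
    rw [lowerCoeff, if_pos (by omega), map_one, one_mul,
      show -(k : ℤ) - 1 = -(k + 1 : ℕ) by push_cast; ring, signedPow_neg, signedPow_neg, pow_succ']
  · obtain ⟨k, rfl⟩ : ∃ k : ℕ, n = (k + 1 : ℕ) := ⟨(n - 1).toNat, by omega⟩
    rw [lowerCoeff, if_neg (by omega), show ((k + 1 : ℕ) : ℤ) - 1 = k by push_cast; ring,
      signedPow_natCast, signedPow_natCast, pow_succ', ← mul_assoc, cE_mul_bE_eq h]

lemma nfCoeff_bE_pow (h : ε ≠ 0) (k : ℕ) : nfCoeff h (bE ε ^ k) = Pi.single (k : ℤ) 1 := by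
  induction k with
  | zero => simp [nfCoeff]
  | succ k ih =>
    rw [pow_succ', nfCoeff_mul, ih, nfRep_bE]
    ext1 n
    simp only [raiseOp, LinearMap.coe_mk, AddHom.coe_mk]
    by_cases hn : n = (k + 1 : ℕ)
    · rw [hn, Pi.single_eq_same, Nat.cast_succ, add_sub_cancel_right, Pi.single_eq_same, map_one,
        raiseCoeff, if_pos (by omega), one_mul]
    · rw [Pi.single_eq_of_ne hn, Pi.single_eq_of_ne (by omega), map_zero, mul_zero]

lemma nfCoeff_cE_pow (h : ε ≠ 0) (k : ℕ) : nfCoeff h (cE ε ^ k) = Pi.single (-(k : ℤ)) 1 := by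
  induction k with
  | zero => simp [nfCoeff]
  | succ k ih =>
    rw [pow_succ', nfCoeff_mul, ih, nfRep_cE]
    ext1 n
    simp only [lowerOp, LinearMap.coe_mk, AddHom.coe_mk]
    by_cases hn : n = -(k + 1 : ℕ)
    · rw [hn, Pi.single_eq_same, show -((k + 1 : ℕ) : ℤ) + 1 = -k by push_cast; ring,
        Pi.single_eq_same, map_one, lowerCoeff, if_pos (by omega), one_mul]
    · rw [Pi.single_eq_of_ne hn, Pi.single_eq_of_ne (by omega), map_zero, mul_zero]

lemma nfCoeff_signedPow (h : ε ≠ 0) (n : ℤ) : nfCoeff h (signedPow ε n) = Pi.single n 1 := by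
  obtain ⟨k, rfl | rfl⟩ := n.eq_nat_or_neg
  · rw [signedPow_natCast, nfCoeff_bE_pow]
  · rw [signedPow_neg, nfCoeff_cE_pow]

variable (ε) in
/-- The element of `𝒜_ε` with given normal form. -/
def ofNF : (ℤ →₀ ℂ[X][X]) →+ Ae ε :=
  Finsupp.liftAddHom fun n =>
    (AddMonoidHom.mulRight (signedPow ε n)).comp (coeffHom ε).toAddMonoidHom

lemma ofNF_apply (f : ℤ →₀ ℂ[X][X]) :
    ofNF ε f = ∑ n ∈ f.support, coeffHom ε (f n) * signedPow ε n := rfl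

lemma ofNF_single (n : ℤ) (r : ℂ[X][X]) :
    ofNF ε (Finsupp.single n r) = coeffHom ε r * signedPow ε n := by
  simp [ofNF]

lemma coeffHom_mul_signedPow_mem (r : ℂ[X][X]) (n : ℤ) :
    coeffHom ε r * signedPow ε n ∈ AddMonoidHom.mrange (ofNF ε) := ⟨_, ofNF_single n r⟩

lemma mul_mem_range_ofNF {x : Ae ε}
    (hx : ∀ r n, x * (coeffHom ε r * signedPow ε n) ∈ AddMonoidHom.mrange (ofNF ε)) :
    ∀ y ∈ AddMonoidHom.mrange (ofNF ε), x * y ∈ AddMonoidHom.mrange (ofNF ε) := by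
  rintro _ ⟨f, rfl⟩
  rw [ofNF_apply, Finset.mul_sum]
  exact sum_mem fun n _ => hx _ _

lemma ofNF_surjective (h : ε ≠ 0) : Function.Surjective (ofNF ε) := by
  intro x
  suffices ∀ y ∈ AddMonoidHom.mrange (ofNF ε), x * y ∈ AddMonoidHom.mrange (ofNF ε) by
    have h1 : (1 : Ae ε) ∈ AddMonoidHom.mrange (ofNF ε) :=
      ⟨Finsupp.single 0 1, by simp [ofNF_single, signedPow]⟩
    simpa using this 1 h1
  have hcoeff (s : ℂ[X][X]) : ∀ y ∈ AddMonoidHom.mrange (ofNF ε),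
      coeffHom ε s * y ∈ AddMonoidHom.mrange (ofNF ε) :=
    mul_mem_range_ofNF fun r n => by
      rw [← mul_assoc, ← map_mul]
      exact coeffHom_mul_signedPow_mem _ _
  induction x using induction_on h with
  | scalar z => simpa using hcoeff (C (C z))
  | omega => simpa using hcoeff (C X)
  | d => simpa using hcoeff X
  | b =>
    refine mul_mem_range_ofNF fun r n => ?_
    rw [← mul_assoc, mul_coeffHom (omega_comm_bE h) (bE_mul_dE h), mul_assoc, bE_mul_signedPow h]
    exact hcoeff _ _ (coeffHom_mul_signedPow_mem _ _)
  | c =>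
    refine mul_mem_range_ofNF fun r n => ?_
    rw [← mul_assoc, mul_coeffHom (omega_comm_cE h) (cE_mul_dE ε), mul_assoc, cE_mul_signedPow h]
    exact hcoeff _ _ (coeffHom_mul_signedPow_mem _ _)
  | mul x y hx hy => intro z hz; rw [mul_assoc]; exact hx _ (hy _ hz)
  | add x y hx hy => intro z hz; rw [add_mul]; exact add_mem (hx _ hz) (hy _ hz)

lemma nfCoeff_ofNF_mul (h : ε ≠ 0) (f : ℤ →₀ ℂ[X][X]) (y : Ae ε) (k : ℤ) (g : ℤ → ℂ[X][X])
    (hg : ∀ n ∈ f.support, nfCoeff h (signedPow ε n * y) = Pi.single (n + k) (g n)) (m : ℤ) :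
    nfCoeff h (ofNF ε f * y) (m + k) = f m * g m := by
  have hsum : nfCoeff h (ofNF ε f * y) =
      ∑ n ∈ f.support, nfCoeff h (coeffHom ε (f n) * (signedPow ε n * y)) := by
    simp only [nfCoeff, ofNF_apply, Finset.sum_mul, map_sum, LinearMap.sum_apply, mul_assoc]
  rw [hsum, Finset.sum_apply, Finset.sum_eq_single m]
  · by_cases hm : m ∈ f.support
    · rw [nfCoeff_coeffHom_mul, hg m hm, Pi.smul_apply, Pi.single_eq_same, smul_eq_mul]
    · simp [Finsupp.notMem_support_iff.1 hm, nfCoeff]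
  · intro n hn hnm
    rw [nfCoeff_coeffHom_mul, hg n hn, Pi.smul_apply, Pi.single_eq_of_ne (by omega), smul_zero]
  · intro hm
    simp [Finsupp.notMem_support_iff.1 hm, nfCoeff]

lemma nfCoeff_ofNF (h : ε ≠ 0) (f : ℤ →₀ ℂ[X][X]) : nfCoeff h (ofNF ε f) = f := by
  ext1 m
  have := nfCoeff_ofNF_mul h f 1 0 1 (fun n _ => by simp [nfCoeff_signedPow]) m
  simpa using this

end NormalForm

section Center

variable {ε : ℂ} {l : ℕ}

lemma isPrimitiveRoot_inv_sq (hodd : Odd l) (hε : IsPrimitiveRoot ε l) :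
    IsPrimitiveRoot (ε⁻¹ ^ 2) l :=
  hε.inv.pow_of_coprime 2 (Nat.coprime_two_left.2 hodd)

lemma sq_pow_eq_one (hε : IsPrimitiveRoot ε l) : (ε ^ 2) ^ l = 1 := by
  rw [← pow_mul, mul_comm, pow_mul, hε.pow_eq_one, one_pow]

lemma inv_sq_pow_eq_one (hε : IsPrimitiveRoot ε l) : (ε⁻¹ ^ 2) ^ l = 1 := by
  rw [← pow_mul, mul_comm, pow_mul, inv_pow, hε.pow_eq_one, inv_one, one_pow]

lemma bE_pow_mem_center (h : ε ≠ 0) (hl : l ≠ 0) (hε : IsPrimitiveRoot ε l) :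
    bE ε ^ l ∈ Subalgebra.center ℂ (Ae ε) := by
  refine mem_center h ((omega_comm_bE h).pow_right l).symm ((Commute.refl _).pow_left l) ?_ ?_
  · obtain ⟨k, rfl⟩ := Nat.exists_eq_succ_of_ne_zero hl
    have hk : (ε⁻¹ ^ 2) ^ k = ε ^ 2 := by
      have := inv_sq_pow_eq_one hε
      rw [pow_succ] at this
      have h2 : ε⁻¹ ^ 2 * ε ^ 2 = 1 := by rw [← mul_pow, inv_mul_cancel₀ h, one_pow]
      calc (ε⁻¹ ^ 2) ^ k = (ε⁻¹ ^ 2) ^ k * (ε⁻¹ ^ 2 * ε ^ 2) := by rw [h2, mul_one]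
        _ = ε ^ 2 := by rw [← mul_assoc, this, one_mul]
    rw [Commute, SemiconjBy, pow_succ, mul_assoc, bE_mul_cE h, bE_pow_mul_coeffHom h, hk,
      scaleVar_bcPoly h, ← cE_mul_bE_eq h, mul_assoc, ← pow_succ', pow_succ]
  · have := bE_pow_mul_coeffHom h l X
    rw [inv_sq_pow_eq_one hε, scaleVar_one, coeffHom_X] at this
    exact this

lemma cE_pow_mem_center (h : ε ≠ 0) (hl : l ≠ 0) (hε : IsPrimitiveRoot ε l) :
    cE ε ^ l ∈ Subalgebra.center ℂ (Ae ε) := by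
  refine mem_center h ((omega_comm_cE h).pow_right l).symm ?_ ((Commute.refl _).pow_left l) ?_
  · obtain ⟨k, rfl⟩ := Nat.exists_eq_succ_of_ne_zero hl
    have hk : (ε ^ 2) ^ k = ε⁻¹ ^ 2 := by
      have := sq_pow_eq_one hε
      rw [pow_succ] at this
      have h2 : ε ^ 2 * ε⁻¹ ^ 2 = 1 := by rw [← mul_pow, mul_inv_cancel₀ h, one_pow]
      calc (ε ^ 2) ^ k = (ε ^ 2) ^ k * (ε ^ 2 * ε⁻¹ ^ 2) := by rw [h2, mul_one]
        _ = ε⁻¹ ^ 2 := by rw [← mul_assoc, this, one_mul]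
    rw [Commute, SemiconjBy, pow_succ, mul_assoc, cE_mul_bE_eq h, cE_pow_mul_coeffHom h, hk,
      scaleVar_cbPoly h, ← bE_mul_cE h, mul_assoc, ← pow_succ', pow_succ]
  · have := cE_pow_mul_coeffHom h l X
    rw [sq_pow_eq_one hε, scaleVar_one, coeffHom_X] at this
    exact this

lemma dE_pow_mem_center (h : ε ≠ 0) (hε : IsPrimitiveRoot ε l) :
    dE ε ^ l ∈ Subalgebra.center ℂ (Ae ε) := by
  refine mem_center h (omega_comm_dE.pow_right l).symm ?_ ?_ ((Commute.refl _).pow_left l)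
  · have := mul_coeffHom (omega_comm_bE h) (bE_mul_dE h) (X ^ l)
    rw [scaleVar_X_pow (inv_sq_pow_eq_one hε), map_pow, coeffHom_X] at this
    exact this.symm
  · have := mul_coeffHom (omega_comm_cE h) (cE_mul_dE ε) (X ^ l)
    rw [scaleVar_X_pow (sq_pow_eq_one hε), map_pow, coeffHom_X] at this
    exact this.symm

lemma signedPow_mul_dE (h : ε ≠ 0) (n : ℤ) :
    signedPow ε n * dE ε = coeffHom ε (C (C ((ε⁻¹ ^ 2) ^ n)) * X) * signedPow ε n := by
  obtain ⟨k, rfl | rfl⟩ := n.eq_nat_or_neg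
  · rw [signedPow_natCast, zpow_natCast, ← scaleVar_X, ← bE_pow_mul_coeffHom h, coeffHom_X]
  · rw [signedPow_neg, zpow_neg, zpow_natCast, ← inv_pow, ← inv_pow, inv_inv, ← scaleVar_X,
      ← cE_pow_mul_coeffHom h, coeffHom_X]

lemma signedPow_mem_adjoin {n : ℤ} (hn : (l : ℤ) ∣ n) :
    signedPow ε n ∈ Algebra.adjoin ℂ ({ωE ε, bE ε ^ l, cE ε ^ l, dE ε ^ l} : Set (Ae ε)) := by
  obtain ⟨m, rfl⟩ := hn
  obtain ⟨k, rfl | rfl⟩ := m.eq_nat_or_neg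
  · rw [← Nat.cast_mul, signedPow_natCast, pow_mul]
    exact pow_mem (Algebra.subset_adjoin (by simp)) k
  · rw [mul_neg, ← Nat.cast_mul, signedPow_neg, pow_mul]
    exact pow_mem (Algebra.subset_adjoin (by simp)) k

lemma coeffHom_mem_adjoin (hodd : Odd l) (hε : IsPrimitiveRoot ε l) {r : ℂ[X][X]}
    (hr : scaleVar (ε⁻¹ ^ 2) r = r) :
    coeffHom ε r ∈ Algebra.adjoin ℂ ({ωE ε, bE ε ^ l, cE ε ^ l, dE ε ^ l} : Set (Ae ε)) := by
  rw [r.as_sum_support, map_sum]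
  refine sum_mem fun j hj => ?_
  have hj' : r.coeff j ≠ 0 := mem_support_iff.1 hj
  have h1 := coeff_scaleVar (ε⁻¹ ^ 2) r j
  rw [hr] at h1
  have h2 : (C ((ε⁻¹ ^ 2) ^ j) : ℂ[X]) = C 1 :=
    mul_right_cancel₀ hj' (by rw [← h1, C_1, one_mul])
  obtain ⟨k, rfl⟩ := ((isPrimitiveRoot_inv_sq hodd hε).pow_eq_one_iff_dvd j).1 (C_injective h2)
  rw [← C_mul_X_pow_eq_monomial, map_mul, map_pow, coeffHom_X, coeffHom_C, pow_mul]
  refine mul_mem ?_ (pow_mem (Algebra.subset_adjoin (by simp)) k)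
  exact Algebra.adjoin_mono (by simp) (aeval_mem_adjoin_singleton ℂ (ωE ε))

lemma adjoin_le_center (h : ε ≠ 0) (hl : l ≠ 0) (hε : IsPrimitiveRoot ε l) :
    Algebra.adjoin ℂ ({ωE ε, bE ε ^ l, cE ε ^ l, dE ε ^ l} : Set (Ae ε)) ≤
      Subalgebra.center ℂ (Ae ε) := by
  refine Algebra.adjoin_le ?_
  rintro _ (rfl | rfl | rfl | rfl)
  exacts [omega_mem_center h, bE_pow_mem_center h hl hε, cE_pow_mem_center h hl hε,
    dE_pow_mem_center h hε]

lemma raiseCoeff_ne_zero (h : ε ≠ 0) (n : ℤ) : raiseCoeff ε n ≠ 0 := by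
  rw [raiseCoeff]
  split_ifs
  exacts [one_ne_zero, bcPoly_ne_zero h]

lemma center_le_adjoin (h : ε ≠ 0) (hl : l ≠ 0) (hodd : Odd l) (hε : IsPrimitiveRoot ε l) :
    Subalgebra.center ℂ (Ae ε) ≤
      Algebra.adjoin ℂ ({ωE ε, bE ε ^ l, cE ε ^ l, dE ε ^ l} : Set (Ae ε)) := by
  intro x hx
  rw [Subalgebra.mem_center_iff] at hx
  obtain ⟨f, rfl⟩ := ofNF_surjective h x
  have hdvd : ∀ n ∈ f.support, (l : ℤ) ∣ n := by
    intro n hn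
    have h1 := nfCoeff_ofNF_mul h f (dE ε) 0 (fun n => C (C ((ε⁻¹ ^ 2) ^ n)) * X)
      (fun n _ => by
        rw [signedPow_mul_dE h, nfCoeff_coeffHom_mul, nfCoeff_signedPow, add_zero, ← Pi.single_smul,
          smul_eq_mul, mul_one]) n
    rw [← hx, nfCoeff_mul, nfRep_dE, nfCoeff_ofNF, add_zero] at h1
    change X * f n = _ at h1
    have h2 : (C (C ((ε⁻¹ ^ 2) ^ n)) : ℂ[X][X]) = C (C 1) := by
      refine mul_right_cancel₀ (mul_ne_zero X_ne_zero (Finsupp.mem_support_iff.1 hn)) ?_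
      rw [C_1, C_1]
      linear_combination -h1
    exact ((isPrimitiveRoot_inv_sq hodd hε).zpow_eq_one_iff_dvd n).1
      (C_injective (C_injective h2))
  have hinv : ∀ n, scaleVar (ε⁻¹ ^ 2) (f n) = f n := by
    intro n
    have h1 := nfCoeff_ofNF_mul h f (bE ε) 1 (fun n => raiseCoeff ε (n + 1))
      (fun n hn => by
        have hc := adjoin_le_center h hl hε (signedPow_mem_adjoin (ε := ε) (hdvd n hn))
        rw [← Subalgebra.mem_center_iff.1 hc, bE_mul_signedPow h, nfCoeff_coeffHom_mul,
          nfCoeff_signedPow, ← Pi.single_smul, smul_eq_mul, mul_one]) n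
    rw [← hx, nfCoeff_mul, nfRep_bE, nfCoeff_ofNF] at h1
    simp only [raiseOp, LinearMap.coe_mk, AddHom.coe_mk, add_sub_cancel_right] at h1
    exact mul_left_cancel₀ (raiseCoeff_ne_zero h (n + 1)) (h1.trans (mul_comm _ _))
  rw [ofNF_apply]
  exact sum_mem fun n hn =>
    mul_mem (coeffHom_mem_adjoin hodd hε (hinv n)) (signedPow_mem_adjoin (hdvd n hn))

end Center

section Relation

variable {ε : ℂ} {l : ℕ}

lemma eval_Tpol {x y : ℂ} (hxy : x * y = 1) (k : ℕ) : (Tpol k).eval (x + y) = x ^ k + y ^ k := by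
  induction k using Nat.twoStepInduction with
  | zero => simp [Tpol]; norm_num
  | one => simp [Tpol]
  | more k ih1 ih2 =>
    simp only [Tpol, eval_sub, eval_mul, eval_X, ih1, ih2]
    linear_combination (x ^ k + y ^ k) * hxy

lemma prod_range_pow_mul_sub {s : ℂ} (hodd : Odd l) (hs : IsPrimitiveRoot s l) (d y : ℂ) :
    ∏ i ∈ Finset.range l, (s ^ i * d - y) = d ^ l - y ^ l := by
  have : NeZero l := ⟨hodd.pos.ne'⟩
  have h1 := hs.pow_sub_pow_eq_prod_sub_mul y d hodd.pos
  have h2 : ∏ ζ ∈ nthRootsFinset l (1 : ℂ), (y - ζ * d) =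
      ∏ i ∈ Finset.range l, (y - s ^ i * d) := by
    refine (Finset.prod_nbij (s ^ ·) ?_ ?_ ?_ fun _ _ => rfl).symm
    · intro i _
      rw [mem_nthRootsFinset hodd.pos, ← pow_mul, mul_comm, pow_mul, hs.pow_eq_one, one_pow]
    · intro i hi j hj hij
      exact hs.pow_inj (Finset.mem_range.1 hi) (Finset.mem_range.1 hj) hij
    · intro ζ hζ
      obtain ⟨i, hi, rfl⟩ := hs.eq_pow_of_pow_eq_one ((mem_nthRootsFinset hodd.pos _).1 hζ)
      exact ⟨i, by simpa using hi, rfl⟩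
  have h3 : ∏ i ∈ Finset.range l, (s ^ i * d - y) =
      (-1) ^ l * ∏ i ∈ Finset.range l, (y - s ^ i * d) := by
    rw [← Finset.card_range l, ← Finset.prod_const, Finset.card_range, ← Finset.prod_mul_distrib]
    exact Finset.prod_congr rfl fun i _ => by ring
  rw [h3, ← h2, ← h1, hodd.neg_one_pow]
  ring

lemma ext_evalEval {p q : ℂ[X][X]} (hpq : ∀ w d : ℂ, evalEval w d p = evalEval w d q) : p = q := by
  refine eq_of_infinite_eval_eq p q (Set.Infinite.mono ?_
    (Set.infinite_range_of_injective (C_injective (R := ℂ))))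
  rintro _ ⟨d, rfl⟩
  exact Polynomial.funext fun w => hpq w d

lemma evalEval_scaleVar (w d t : ℂ) (p : ℂ[X][X]) :
    evalEval w d (scaleVar t p) = evalEval w (t * d) p := by
  have : (evalEvalRingHom w d).comp (scaleVar t : ℂ[X][X] →+* ℂ[X][X]) =
      evalEvalRingHom w (t * d) := by
    refine ringHom_ext' (ringHom_ext (fun z => ?_) ?_) ?_ <;> simp
  exact DFunLike.congr_fun this p

lemma prod_scaleVar_bcPoly (hodd : Odd l) (hε : IsPrimitiveRoot ε l) :
    ∏ i ∈ Finset.range l, scaleVar ((ε⁻¹ ^ 2) ^ i) (bcPoly ε) =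
      (C (Tpol l) - X ^ l) * X ^ l - 1 := by
  have h : ε ≠ 0 := hε.ne_zero hodd.pos.ne'
  refine ext_evalEval fun w d => ?_
  obtain ⟨s, hs⟩ := IsAlgClosed.exists_pow_nat_eq (w ^ 2 - 4) (n := 2) two_pos
  obtain ⟨x, y, hxy, rfl⟩ : ∃ x y : ℂ, x * y = 1 ∧ x + y = w :=
    ⟨(w + s) / 2, (w - s) / 2, by linear_combination -hs / 4, by ring⟩
  have hP (d : ℂ) : evalEval (x + y) d (bcPoly ε) = -ε⁻¹ ^ 4 * ((d - ε * x) * (d - ε * y)) := by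
    simp only [bcPoly, evalEval_sub, evalEval_mul, evalEval_pow, evalEval_C, evalEval_X, eval_mul,
      eval_C, eval_X]
    field_simp
    linear_combination ε ^ 2 * hxy
  have hL : evalEval (x + y) d (∏ i ∈ Finset.range l, scaleVar ((ε⁻¹ ^ 2) ^ i) (bcPoly ε)) =
      ∏ i ∈ Finset.range l, evalEval (x + y) ((ε⁻¹ ^ 2) ^ i * d) (bcPoly ε) := by
    rw [← coe_evalEvalRingHom, map_prod]
    simp only [coe_evalEvalRingHom, evalEval_scaleVar]
  have hs := isPrimitiveRoot_inv_sq hodd hε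
  have hε4 : (-ε⁻¹ ^ 4) ^ l = -1 := by
    rw [hodd.neg_pow, ← pow_mul, mul_comm, pow_mul, inv_pow, hε.pow_eq_one, inv_one, one_pow]
  rw [hL]
  simp only [hP, Finset.prod_mul_distrib, Finset.prod_const, Finset.card_range,
    prod_range_pow_mul_sub hodd hs, hε4, mul_pow, hε.pow_eq_one, one_mul, evalEval_sub,
    evalEval_mul, evalEval_pow, evalEval_C, evalEval_X, eval_Tpol hxy, evalEval_one]
  have hl : x ^ l * y ^ l = 1 := by rw [← mul_pow, hxy, one_pow]
  linear_combination -hl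

lemma bE_pow_mul_cE_pow (h : ε ≠ 0) (k : ℕ) : bE ε ^ k * cE ε ^ k =
    coeffHom ε (∏ i ∈ Finset.range k, scaleVar ((ε⁻¹ ^ 2) ^ i) (bcPoly ε)) := by
  induction k with
  | zero => simp
  | succ k ih =>
    rw [pow_succ', pow_succ, mul_assoc, ← mul_assoc _ _ (cE ε), ih, ← mul_assoc,
      mul_coeffHom (omega_comm_bE h) (bE_mul_dE h), mul_assoc, bE_mul_cE h, ← map_mul, map_prod,
      Finset.prod_range_succ']
    simp only [scaleVar_scaleVar, pow_succ', pow_zero, scaleVar_one]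

lemma bE_pow_mul_cE_pow_eq (hodd : Odd l) (hε : IsPrimitiveRoot ε l) :
    bE ε ^ l * cE ε ^ l = (aeval (ωE ε) (Tpol l) - dE ε ^ l) * dE ε ^ l - 1 := by
  rw [bE_pow_mul_cE_pow (hε.ne_zero hodd.pos.ne'), prod_scaleVar_bcPoly hodd hε]
  simp

end Relation

section Kernel

variable {ε : ℂ} {l : ℕ}

/-- The inclusion of `ℂ[W, B, D]` into `ℂ[W, B, C, D]`. -/
def omitC : MvPolynomial (Fin 3) ℂ →ₐ[ℂ] MvPolynomial (Fin 4) ℂ :=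
  MvPolynomial.aeval ![MvPolynomial.X 0, MvPolynomial.X 1, MvPolynomial.X 3]

lemma exists_relCenter_dvd_sub_omitC (l : ℕ) (p : MvPolynomial (Fin 4) ℂ) :
    ∃ (N : ℕ) (q : MvPolynomial (Fin 3) ℂ),
      relCenter l ∣ MvPolynomial.X 1 ^ N * p - omitC q := by
  have h0 : omitC (MvPolynomial.X 0) = MvPolynomial.X 0 := by simp [omitC]
  have h1 : omitC (MvPolynomial.X 1) = MvPolynomial.X 1 := by simp [omitC]
  have h2 : omitC (MvPolynomial.X 2) = MvPolynomial.X 3 := by simp [omitC]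
  induction p using MvPolynomial.induction_on with
  | C z => exact ⟨0, MvPolynomial.C z, by simp [omitC, MvPolynomial.algebraMap_eq]⟩
  | add p p' hp hp' =>
    obtain ⟨N, q, r, hr⟩ := hp
    obtain ⟨N', q', r', hr'⟩ := hp'
    refine ⟨N + N', MvPolynomial.X 1 ^ N' * q + MvPolynomial.X 1 ^ N * q',
      MvPolynomial.X 1 ^ N' * r + MvPolynomial.X 1 ^ N * r', ?_⟩
    rw [map_add, map_mul, map_mul, map_pow, map_pow, h1]
    linear_combination MvPolynomial.X 1 ^ N' * hr + MvPolynomial.X 1 ^ N * hr'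
  | mul_X p i hp =>
    obtain ⟨N, q, r, hr⟩ := hp
    obtain rfl | rfl | rfl | rfl : i = 0 ∨ i = 1 ∨ i = 2 ∨ i = 3 := by fin_cases i <;> simp
    · refine ⟨N, q * MvPolynomial.X 0, r * MvPolynomial.X 0, ?_⟩
      rw [map_mul, h0]
      linear_combination MvPolynomial.X 0 * hr
    · refine ⟨N, q * MvPolynomial.X 1, r * MvPolynomial.X 1, ?_⟩
      rw [map_mul, h1]
      linear_combination MvPolynomial.X 1 * hr
    · refine ⟨N + 1, q * ((aeval (MvPolynomial.X 0) (Tpol l) - MvPolynomial.X 2) *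
        MvPolynomial.X 2 - 1), r * (MvPolynomial.X 1 * MvPolynomial.X 2) - omitC q, ?_⟩
      simp only [map_mul, map_sub, map_one, h2, ← aeval_algHom_apply, h0]
      simp only [relCenter] at hr ⊢
      linear_combination MvPolynomial.X 1 * MvPolynomial.X 2 * hr
    · refine ⟨N, q * MvPolynomial.X 2, r * MvPolynomial.X 3, ?_⟩
      rw [map_mul, h2]
      linear_combination MvPolynomial.X 3 * hr

lemma not_X_dvd_relCenter (l : ℕ) : ¬ MvPolynomial.X 1 ∣ relCenter l := by
  intro H
  have := map_dvd (MvPolynomial.aeval ![(0 : ℂ), 0, 0, 0]) H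
  simp [relCenter] at this

lemma relCenter_dvd_of_dvd_X_pow_mul {p : MvPolynomial (Fin 4) ℂ} (N : ℕ)
    (H : relCenter l ∣ MvPolynomial.X 1 ^ N * p) : relCenter l ∣ p := by
  induction N with
  | zero => simpa using H
  | succ N ih =>
    obtain ⟨q, hq⟩ := H
    have hX : (MvPolynomial.X 1 : MvPolynomial (Fin 4) ℂ) ∣ relCenter l * q :=
      ⟨MvPolynomial.X 1 ^ N * p, by rw [← hq, pow_succ', mul_assoc]⟩
    obtain ⟨r, rfl⟩ := (MvPolynomial.X_prime.dvd_or_dvd hX).resolve_left (not_X_dvd_relCenter l)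
    refine ih ⟨r, mul_left_cancel₀ (MvPolynomial.X_ne_zero (R := ℂ) (1 : Fin 4)) ?_⟩
    linear_combination hq

lemma coeff_nfCoeff_omitC (h : ε ≠ 0) (hl : l ≠ 0) {φ : MvPolynomial (Fin 4) ℂ →ₐ[ℂ] Ae ε}
    (hW : φ (MvPolynomial.X 0) = ωE ε) (hB : φ (MvPolynomial.X 1) = bE ε ^ l)
    (hD : φ (MvPolynomial.X 3) = dE ε ^ l) (q : MvPolynomial (Fin 3) ℂ) (m : Fin 3 →₀ ℕ) :
    ((nfCoeff h (φ (omitC q)) ((l * m 1 : ℕ) : ℤ)).coeff (l * m 2)).coeff (m 0) =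
      MvPolynomial.coeff m q := by
  induction q using MvPolynomial.induction_on' with
  | monomial m' z =>
    have hmon : φ (omitC (MvPolynomial.monomial m' z)) =
        coeffHom ε (C (C z * X ^ m' 0) * X ^ (l * m' 2)) * bE ε ^ (l * m' 1) := by
      have : (MvPolynomial.monomial m' z : MvPolynomial (Fin 3) ℂ) = MvPolynomial.C z *
          (MvPolynomial.X 0 ^ m' 0 * MvPolynomial.X 2 ^ m' 2 * MvPolynomial.X 1 ^ m' 1) := by
        rw [MvPolynomial.monomial_eq, Finsupp.prod_fintype _ _ (by simp), Fin.prod_univ_three]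
        ring
      rw [this]
      simp [omitC, hW, hB, hD, pow_mul, mul_assoc]
    rw [hmon, nfCoeff_coeffHom_mul, nfCoeff_bE_pow, MvPolynomial.coeff_monomial]
    by_cases hm1 : m' 1 = m 1
    · rw [hm1, Pi.smul_apply, Nat.cast_mul, Pi.single_eq_same, smul_eq_mul, mul_one,
        coeff_C_mul_X_pow]
      by_cases hm2 : m 2 = m' 2
      · rw [if_pos (congrArg (l * ·) hm2), coeff_C_mul_X_pow]
        refine if_congr ⟨fun hm0 => ?_, fun hm => by rw [hm]⟩ rfl rfl
        ext i
        obtain rfl | rfl | rfl : i = 0 ∨ i = 1 ∨ i = 2 := by fin_cases i <;> simp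
        exacts [hm0.symm, hm1, hm2.symm]
      · rw [if_neg (mt (mul_left_cancel₀ hl) hm2), coeff_zero, if_neg fun hm => hm2 (by rw [hm])]
    · have hne : ((l * m 1 : ℕ) : ℤ) ≠ ((l * m' 1 : ℕ) : ℤ) := by
        rw [Ne, Nat.cast_inj, mul_right_inj' hl]
        exact Ne.symm hm1
      rw [Pi.smul_apply, Pi.single_eq_of_ne hne, smul_zero, coeff_zero, coeff_zero,
        if_neg fun hm => hm1 (by rw [hm])]
  | add p q hp hq =>
    rw [map_add, map_add, MvPolynomial.coeff_add, ← hp, ← hq]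
    simp [nfCoeff]

lemma ker_eq_span (hodd : Odd l) (hε : IsPrimitiveRoot ε l)
    {φ : MvPolynomial (Fin 4) ℂ →ₐ[ℂ] Ae ε}
    (hW : φ (MvPolynomial.X 0) = ωE ε) (hB : φ (MvPolynomial.X 1) = bE ε ^ l)
    (hC : φ (MvPolynomial.X 2) = cE ε ^ l) (hD : φ (MvPolynomial.X 3) = dE ε ^ l) :
    RingHom.ker φ = Ideal.span {relCenter l} := by
  have h : ε ≠ 0 := hε.ne_zero hodd.pos.ne'
  have hrel : φ (relCenter l) = 0 := by
    rw [relCenter]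
    simp only [map_sub, map_mul, map_one, ← aeval_algHom_apply, hW, hB, hC, hD,
      bE_pow_mul_cE_pow_eq hodd hε]
    abel
  ext p
  rw [RingHom.mem_ker, Ideal.mem_span_singleton]
  refine ⟨fun hp => ?_, ?_⟩
  · obtain ⟨N, q, r, hr⟩ := exists_relCenter_dvd_sub_omitC l p
    have hq0 : φ (omitC q) = 0 := by
      have := congrArg φ hr
      rw [map_sub, map_mul, map_mul, hp, hrel, mul_zero, zero_mul, zero_sub, neg_eq_zero] at this
      exact this
    have hq : q = 0 := by
      ext m
      rw [← coeff_nfCoeff_omitC h hodd.pos.ne' hW hB hD, hq0]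
      simp [nfCoeff]
    refine relCenter_dvd_of_dvd_X_pow_mul N ⟨r, ?_⟩
    rw [← hr, hq, map_zero, sub_zero]
  · rintro ⟨r, rfl⟩
    rw [map_mul, hrel, zero_mul]

lemma exists_algHom (h : ε ≠ 0) (hl : l ≠ 0) (hε : IsPrimitiveRoot ε l) :
    ∃ φ : MvPolynomial (Fin 4) ℂ →ₐ[ℂ] Ae ε,
      φ (MvPolynomial.X 0) = ωE ε ∧ φ (MvPolynomial.X 1) = bE ε ^ l
      ∧ φ (MvPolynomial.X 2) = cE ε ^ l ∧ φ (MvPolynomial.X 3) = dE ε ^ l := by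
  refine ⟨(Subalgebra.center ℂ (Ae ε)).val.comp (MvPolynomial.aeval
    ![⟨_, omega_mem_center h⟩, ⟨_, bE_pow_mem_center h hl hε⟩, ⟨_, cE_pow_mem_center h hl hε⟩,
      ⟨_, dE_pow_mem_center h hε⟩]), ?_, ?_, ?_, ?_⟩ <;> simp

end Kernel

end Ae

/-- Let `l ≥ 3` be odd and `ε` a primitive `l`-th root of unity.  The center of `𝒜_ε` is
the subalgebra generated by `ω, b^l, c^l, d^l`; moreover there is a `ℂ`-algebra
homomorphism `ℂ[W,B,C,D] → 𝒜_ε` sending `W, B, C, D` to `ω, b^l, c^l, d^l`, and the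
kernel of any such homomorphism is the ideal generated by `(T_l(W) - D)D - BC - 1`; hence
the center of `𝒜_ε` is isomorphic to `ℂ[W,B,C,D]/((T_l(W) - D)D - BC - 1)`. -/
theorem statement11 (l : ℕ) (hl : 3 ≤ l) (hodd : Odd l)
    (ε : ℂ) (hε : IsPrimitiveRoot ε l) :
    Subalgebra.center ℂ (Ae ε)
      = Algebra.adjoin ℂ ({ωE ε, bE ε ^ l, cE ε ^ l, dE ε ^ l} : Set (Ae ε))
    ∧ (∃ φ : MvPolynomial (Fin 4) ℂ →ₐ[ℂ] Ae ε,
        φ (MvPolynomial.X 0) = ωE ε ∧ φ (MvPolynomial.X 1) = bE ε ^ l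
        ∧ φ (MvPolynomial.X 2) = cE ε ^ l ∧ φ (MvPolynomial.X 3) = dE ε ^ l)
    ∧ ∀ φ : MvPolynomial (Fin 4) ℂ →ₐ[ℂ] Ae ε,
        φ (MvPolynomial.X 0) = ωE ε → φ (MvPolynomial.X 1) = bE ε ^ l →
        φ (MvPolynomial.X 2) = cE ε ^ l → φ (MvPolynomial.X 3) = dE ε ^ l →
        RingHom.ker φ = Ideal.span {relCenter l} := by
  have h : ε ≠ 0 := hε.ne_zero (by omega)
  have hl0 : l ≠ 0 := by omega
  exact ⟨le_antisymm (Ae.center_le_adjoin h hl0 hodd hε) (Ae.adjoin_le_center h hl0 hε),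
    Ae.exists_algHom h hl0 hε, fun φ hW hB hC hD => Ae.ker_eq_span hodd hε hW hB hC hD⟩
end
end
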